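/- Let H be a noetherian Hopf algebra over a field k with bijective antipode. Then H is AS Gorenstein if and only if H has finite Gorenstein global dimension and both Ext^i_H(εk, H) and Ext^i_{H^op}(k_ε, H) are finite dimensional over k for all i. -/

import Mathlib

open TensorProduct

universe u

noncomputable section GorensteinCore

/-- `ProjDimLE R n M` : the left `R`-module `M` has a projective resolution of length `≤ n`. -/
def ProjDimLE (R : Type u) [Ring R] : ℕ → (M : Type u) → [AddCommGroup M] → [Module R M] → Prop
  | 0, M, _, _ => Module.Projective R M
  | (n+1), M, _, _ => Module.Projective R M ∨
      ∃ (P : ModuleCat.{u} R) (f : P →ₗ[R] M), Module.Projective R P ∧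
      Function.Surjective f ∧ ProjDimLE R n (LinearMap.ker f)

/-- The projective dimension of a module, as an element of `ℕ∞` (`⊤` = infinite). -/
def projDim (R : Type u) [Ring R] (M : Type u) [AddCommGroup M] [Module R M] : ℕ∞ :=
  sInf {n : ℕ∞ | ∃ m : ℕ, n = (m : ℕ∞) ∧ ProjDimLE R m M}

/-- A module is Gorenstein projective if it is a syzygy of a totally acyclic complex of
projective modules. -/
def IsGorensteinProjective (R : Type u) [Ring R] (M : Type u) [AddCommGroup M] [Module R M] :
    Prop :=
  ∃ (P : ℤ → ModuleCat.{u} R) (d : ∀ i : ℤ, P (i+1) →ₗ[R] P i),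
    (∀ i, Module.Projective R (P i)) ∧
    (∀ i, LinearMap.range (d (i+1)) = LinearMap.ker (d i)) ∧
    (∀ (Q : ModuleCat.{u} R), Module.Projective R Q →
      ∀ (i : ℤ) (f : P (i+1) →ₗ[R] Q), f.comp (d (i+1)) = 0 →
        ∃ g : P i →ₗ[R] Q, g.comp (d i) = f) ∧
    Nonempty (M ≃ₗ[R] LinearMap.ker (d 0))

/-- `GProjDimLE R n M` : `M` has a Gorenstein projective resolution of length `≤ n`. -/
def GProjDimLE (R : Type u) [Ring R] : ℕ → (M : Type u) → [AddCommGroup M] → [Module R M] → Prop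
  | 0, M, _, _ => IsGorensteinProjective R M
  | (n+1), M, _, _ => IsGorensteinProjective R M ∨
      ∃ (G : ModuleCat.{u} R) (f : G →ₗ[R] M), IsGorensteinProjective R G ∧
      Function.Surjective f ∧ GProjDimLE R n (LinearMap.ker f)

/-- The Gorenstein projective dimension of a module, as an element of `ℕ∞`. -/
def gProjDim (R : Type u) [Ring R] (M : Type u) [AddCommGroup M] [Module R M] : ℕ∞ :=
  sInf {n : ℕ∞ | ∃ m : ℕ, n = (m : ℕ∞) ∧ GProjDimLE R m M}

/-- The (left) Gorenstein global dimension of a ring `R`. -/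
def lGgldim (R : Type u) [Ring R] : ℕ∞ :=
  ⨆ M : ModuleCat.{u} R, gProjDim R M

/-- The (left) global dimension of a ring `R`. -/
def lgldim (R : Type u) [Ring R] : ℕ∞ :=
  ⨆ M : ModuleCat.{u} R, projDim R M

/-- `InjDimLE R n M` : the left `R`-module `M` has an injective resolution of length `≤ n`. -/
def InjDimLE (R : Type u) [Ring R] : ℕ → (M : Type u) → [AddCommGroup M] → [Module R M] → Prop
  | 0, M, _, _ => Module.Injective R M
  | (n+1), M, _, _ => Module.Injective R M ∨
      ∃ (I : ModuleCat.{u} R) (f : M →ₗ[R] I), Module.Injective R I ∧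
      Function.Injective f ∧ InjDimLE R n (I ⧸ LinearMap.range f)

/-- The injective dimension of a module, as an element of `ℕ∞`. -/
def injDim (R : Type u) [Ring R] (M : Type u) [AddCommGroup M] [Module R M] : ℕ∞ :=
  sInf {n : ℕ∞ | ∃ m : ℕ, n = (m : ℕ∞) ∧ InjDimLE R m M}

/-- `silp R` : the supremum of the injective dimensions of projective left `R`-modules. -/
def silp (R : Type u) [Ring R] : ℕ∞ :=
  ⨆ (M : ModuleCat.{u} R) (_ : Module.Projective R M), injDim R M

/-- `spli R` : the supremum of the projective dimensions of injective left `R`-modules. -/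
def spli (R : Type u) [Ring R] : ℕ∞ :=
  ⨆ (M : ModuleCat.{u} R) (_ : Module.Injective R M), projDim R M

end GorensteinCore
noncomputable section HopfCore

variable (k : Type u) [CommRing k] (H : Type u) [Ring H] [HopfAlgebra k H]

/-- The trivial left `H`-module structure on `k`, given by the counit. -/
def trivModule : Module H k :=
  Module.compHom k ((Bialgebra.counitAlgHom k H : H →ₐ[k] k) : H →+* k)

/-- The trivial left `H`-module `εk`, as an object of `ModuleCat H`. -/
def trivMod : ModuleCat.{u} H :=
  @ModuleCat.of H _ k _ (trivModule k H)

/-- The counit of `H`, as a ring homomorphism out of `Hᵐᵒᵖ`. -/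
def counitOp : Hᵐᵒᵖ →+* k :=
  RingHom.fromOpposite ((Bialgebra.counitAlgHom k H : H →ₐ[k] k) : H →+* k)
    (fun _ _ => mul_comm _ _)

/-- The trivial right `H`-module structure on `k` (as a left `Hᵐᵒᵖ`-module). -/
def trivModuleOp : Module Hᵐᵒᵖ k :=
  Module.compHom k (counitOp k H)

/-- The trivial right `H`-module `k_ε`, as an object of `ModuleCat Hᵐᵒᵖ`. -/
def trivModOp : ModuleCat.{u} Hᵐᵒᵖ :=
  @ModuleCat.of Hᵐᵒᵖ _ k _ (trivModuleOp k H)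

section TensorAction

variable (M N : Type u) [AddCommGroup M] [Module k M] [Module H M]
  [IsScalarTower k H M] [SMulCommClass k H M]
  [AddCommGroup N] [Module k N] [Module H N] [IsScalarTower k H N] [SMulCommClass k H N]

/-- The representation of `H` on a left `H`-module `M`, as an algebra morphism to
`End_k(M)`. -/
def hRep : H →ₐ[k] Module.End k M :=
  (Algebra.lsmul k k M : H →ₐ[k] Module.End k M)

/-- The representation of `H` on `M ⊗[k] N` given by the comultiplication of `H`:
`h • (m ⊗ n) = ∑ h₁ • m ⊗ h₂ • n`. -/
def tensorRep : H →ₐ[k] Module.End k (M ⊗[k] N) :=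
  ((Module.endTensorEndAlgHom (R := k) (S := k) (A := k) (M := M) (N := N)).comp
    (Algebra.TensorProduct.map (hRep k H M) (hRep k H N))).comp
    (Bialgebra.comulAlgHom k H)

/-- The diagonal left `H`-module structure on `M ⊗[k] N`:
`h • (m ⊗ n) = ∑ h₁ • m ⊗ h₂ • n`. -/
def tensorModule : Module H (M ⊗[k] N) :=
  Module.compHom (M ⊗[k] N)
    ((tensorRep k H M N).toRingHom : H →+* Module.End k (M ⊗[k] N))

/-- The tensor product `M ⊗[k] N` with its diagonal left `H`-module structure, as an
object of `ModuleCat H`. -/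
def tensorMod : ModuleCat.{u} H :=
  @ModuleCat.of H _ (M ⊗[k] N) _ (tensorModule k H M N)

end TensorAction

end HopfCore


noncomputable section ExtDefs

variable (k : Type u) [CommRing k] (R : Type u) [Ring R] [Algebra k R]

/-- Precomposition with the differential, i.e. the differential of the complex
`Hom_R(P_•, R)`, as a `k`-linear map. -/
def extδ (P : ℕ → ModuleCat.{u} R) (dif : ∀ n, P (n+1) →ₗ[R] P n) (n : ℕ) :
    ((P n) →ₗ[R] R) →ₗ[k] ((P (n+1)) →ₗ[R] R) where
  toFun f := f.comp (dif n)
  map_add' f g := LinearMap.add_comp _ _ _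
  map_smul' c f := LinearMap.smul_comp _ _ _

/-- The coboundaries of the complex `Hom_R(P_•, R)`. -/
def extBoundary (P : ℕ → ModuleCat.{u} R) (dif : ∀ n, P (n+1) →ₗ[R] P n) :
    (n : ℕ) → Submodule k ((P n) →ₗ[R] R)
  | 0 => ⊥
  | (n+1) => LinearMap.range (extδ k R P dif n)

/-- Quotient of a submodule by a submodule of it. -/
abbrev subQuot {k : Type u} [CommRing k] {M : Type u} [AddCommGroup M] [Module k M]
    (T : Submodule k M) (C : Submodule k ↥T) : Type u := ↥T ⧸ C

/-- The Ext group `Ext^n_R(M, R)` computed from a projective resolution `P_• → M`: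
the quotient of the cocycles by the coboundaries of the complex `Hom_R(P_•, R)`. -/
abbrev extGrp (P : ℕ → ModuleCat.{u} R) (dif : ∀ n, P (n+1) →ₗ[R] P n) (n : ℕ) : Type u :=
  subQuot (LinearMap.ker (extδ k R P dif n))
    ((extBoundary k R P dif n).comap (LinearMap.ker (extδ k R P dif n)).subtype)

end ExtDefs

noncomputable section ASG

variable (k : Type u) [Field k] (H : Type u) [Ring H] [HopfAlgebra k H]

/-- `H` is Artin-Schelter Gorenstein of dimension `dd`: the left regular module has
injective dimension `dd`, and for the trivial module `εk` one has `Ext^i_H(εk, H) = 0`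
for `i ≠ dd` and `Ext^dd_H(εk, H) ≅ k` (Ext computed from any projective resolution of
`εk`). -/
def IsASGorensteinOfDim (dd : ℕ) : Prop :=
  injDim H H = (dd : ℕ∞) ∧
  ∀ (P : ℕ → ModuleCat.{u} H) (dif : ∀ n, P (n+1) →ₗ[H] P n)
    (aug : P 0 →ₗ[H] trivMod k H),
    (∀ n, Module.Projective H (P n)) → Function.Surjective aug →
    LinearMap.ker aug = LinearMap.range (dif 0) →
    (∀ n, LinearMap.ker (dif n) = LinearMap.range (dif (n+1))) →
    (∀ i : ℕ, i ≠ dd → Subsingleton (extGrp k H P dif i)) ∧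
    Nonempty (extGrp k H P dif dd ≃ₗ[k] k)

/-- `H` is Artin-Schelter Gorenstein. -/
def IsASGorenstein : Prop := ∃ dd : ℕ, IsASGorensteinOfDim k H dd

end ASG

section ExtSequences

open CategoryTheory CategoryTheory.Abelian

variable {R : Type u} [Ring R]
variable {A B C : Type u} [AddCommGroup A] [AddCommGroup B] [AddCommGroup C]
  [Module R A] [Module R B] [Module R C]

/-- The Ext groups of two modules. -/
abbrev ModExt (R : Type u) [Ring R] (M N : Type u) [AddCommGroup M] [Module R M]
    [AddCommGroup N] [Module R N] (n : ℕ) : Type u :=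
  Ext (ModuleCat.of R M) (ModuleCat.of R N) n

variable (N : Type u) [AddCommGroup N] [Module R N]

theorem exists_shortExact (f : A →ₗ[R] B) (g : B →ₗ[R] C) (hf : Function.Injective f)
    (hg : Function.Surjective g) (hfg : LinearMap.range f = LinearMap.ker g) :
    ∃ w : ModuleCat.ofHom f ≫ ModuleCat.ofHom g = 0,
      (ShortComplex.mk (ModuleCat.ofHom f) (ModuleCat.ofHom g) w).ShortExact := by
  have e : Function.Exact f g := fun x => by
    rw [← LinearMap.mem_ker, ← hfg]; rfl
  have e0 : g.comp f = 0 := e.linearMap_comp_eq_zero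
  refine ⟨by rw [← ModuleCat.ofHom_comp, e0]; rfl, ?_⟩
  exact ModuleCat.shortComplex_shortExact _ e hf hg

theorem ModExt.subsingleton_of_projective [Module.Projective R A] (n : ℕ) :
    Subsingleton (ModExt R A N (n + 1)) := by
  have : Projective (ModuleCat.of R A) := inferInstance
  exact ⟨fun x y => (Ext.eq_zero_of_projective x).trans (Ext.eq_zero_of_projective y).symm⟩

theorem ModExt.subsingleton_congr (e : A ≃ₗ[R] B) (n : ℕ) [Subsingleton (ModExt R B N n)] :
    Subsingleton (ModExt R A N n) := by
  refine ⟨fun x y => ?_⟩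
  have key (x : ModExt R A N n) : x = (Ext.mk₀ e.toModuleIso.hom).comp
      ((Ext.mk₀ e.toModuleIso.inv).comp x (zero_add n)) (zero_add n) := by
    rw [Ext.mk₀_comp_mk₀_assoc, Iso.hom_inv_id, Ext.mk₀_id_comp]
  rw [key x, key y, Subsingleton.elim ((Ext.mk₀ e.toModuleIso.inv).comp x (zero_add n))
    ((Ext.mk₀ e.toModuleIso.inv).comp y (zero_add n))]

variable (f : A →ₗ[R] B) (g : B →ₗ[R] C)

theorem ModExt.subsingleton_mid (hf : Function.Injective f) (hg : Function.Surjective g)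
    (hfg : LinearMap.range f = LinearMap.ker g)
    (n : ℕ) [Subsingleton (ModExt R A N n)]
    [Subsingleton (ModExt R C N n)] : Subsingleton (ModExt R B N n) := by
  obtain ⟨w, hS⟩ := exists_shortExact f g hf hg hfg
  refine subsingleton_of_forall_eq 0 fun x => ?_
  obtain ⟨y, rfl⟩ := Ext.contravariant_sequence_exact₂ hS _ x (Subsingleton.elim (α := ModExt R A N n) _ _)
  rw [Subsingleton.elim (α := ModExt R C N n) y 0, Ext.comp_zero]

theorem ModExt.subsingleton_left (hf : Function.Injective f) (hg : Function.Surjective g)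
    (hfg : LinearMap.range f = LinearMap.ker g)
    (n : ℕ) [Subsingleton (ModExt R B N n)]
    [Subsingleton (ModExt R C N (n + 1))] : Subsingleton (ModExt R A N n) := by
  obtain ⟨w, hS⟩ := exists_shortExact f g hf hg hfg
  refine subsingleton_of_forall_eq 0 fun x => ?_
  obtain ⟨y, rfl⟩ := Ext.contravariant_sequence_exact₁ hS _ x (add_comm 1 n)
    (Subsingleton.elim (α := ModExt R C N (n + 1)) _ _)
  rw [Subsingleton.elim (α := ModExt R B N n) y 0, Ext.comp_zero]

theorem ModExt.subsingleton_right (hf : Function.Injective f) (hg : Function.Surjective g)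
    (hfg : LinearMap.range f = LinearMap.ker g)
    (n : ℕ) [Subsingleton (ModExt R A N n)]
    [Subsingleton (ModExt R B N (n + 1))] : Subsingleton (ModExt R C N (n + 1)) := by
  obtain ⟨w, hS⟩ := exists_shortExact f g hf hg hfg
  refine subsingleton_of_forall_eq 0 fun x => ?_
  obtain ⟨y, rfl⟩ := Ext.contravariant_sequence_exact₃ hS _ x
    (Subsingleton.elim (α := ModExt R B N (n + 1)) _ _) (add_comm 1 n)
  rw [Subsingleton.elim (α := ModExt R A N n) y 0, Ext.comp_zero]

theorem ModExt.exists_extension (hf : Function.Injective f) (hg : Function.Surjective g)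
    (hfg : LinearMap.range f = LinearMap.ker g)
    [Subsingleton (ModExt R C N 1)] (φ : A →ₗ[R] N) :
    ∃ ψ : B →ₗ[R] N, ψ.comp f = φ := by
  obtain ⟨w, hS⟩ := exists_shortExact f g hf hg hfg
  obtain ⟨y, hy⟩ := Ext.contravariant_sequence_exact₁ hS (ModuleCat.of R N)
    (Ext.mk₀ (ModuleCat.ofHom φ)) (add_comm 1 0)
    (Subsingleton.elim (α := ModExt R C N 1) _ _)
  obtain ⟨ψ, rfl⟩ := Ext.homEquiv₀.symm.surjective y
  have : Ext.homEquiv₀.symm ψ = Ext.mk₀ ψ := rfl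
  rw [this, Ext.mk₀_comp_mk₀] at hy
  have h2 := congrArg ModuleCat.Hom.hom ((Ext.mk₀_bijective _ _).1 hy)
  exact ⟨ψ.hom, h2⟩

theorem ModExt.nonempty_equiv_shift (hf : Function.Injective f) (hg : Function.Surjective g)
    (hfg : LinearMap.range f = LinearMap.ker g)
    (k : Type u) [Field k] [Algebra k R]
    [Module.Projective R B] (n : ℕ) :
    Nonempty (ModExt R A N (n + 1) ≃ₗ[k] ModExt R C N (n + 2)) := by
  obtain ⟨w, hS⟩ := exists_shortExact f g hf hg hfg
  have hB : Projective (ModuleCat.of R B) := inferInstance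
  refine ⟨LinearEquiv.ofBijective
    ((Ext.bilinearCompOfLinear k (ModuleCat.of R C) (ModuleCat.of R A) (ModuleCat.of R N) 1 (n+1) (n+2)
      (by omega)) hS.extClass) ⟨?_, ?_⟩⟩
  · rw [injective_iff_map_eq_zero]
    intro x hx
    obtain ⟨y, rfl⟩ := Ext.contravariant_sequence_exact₁ hS _ x (by omega : 1 + (n+1) = n+2) hx
    rw [Ext.eq_zero_of_projective (P := ModuleCat.of R B) y, Ext.comp_zero]
  · intro y
    obtain ⟨x, hx⟩ := Ext.contravariant_sequence_exact₃ hS _ y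
      (Ext.eq_zero_of_projective (P := ModuleCat.of R B) _) (by omega : 1 + (n+1) = n+2)
    exact ⟨x, hx⟩

theorem ModExt.nonempty_equiv_left (hf : Function.Injective f) (hg : Function.Surjective g)
    (hfg : LinearMap.range f = LinearMap.ker g)
    (k : Type u) [Field k] [Algebra k R]
    (n : ℕ) [Subsingleton (ModExt R C N n)]
    [Subsingleton (ModExt R C N (n + 1))] :
    Nonempty (ModExt R B N n ≃ₗ[k] ModExt R A N n) := by
  obtain ⟨w, hS⟩ := exists_shortExact f g hf hg hfg
  refine ⟨LinearEquiv.ofBijective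
    ((Ext.bilinearCompOfLinear k (ModuleCat.of R A) (ModuleCat.of R B) (ModuleCat.of R N) 0 n n
      (by omega)) (Ext.mk₀ (ModuleCat.ofHom f))) ⟨?_, ?_⟩⟩
  · rw [injective_iff_map_eq_zero]
    intro x hx
    obtain ⟨y, rfl⟩ := Ext.contravariant_sequence_exact₂ hS _ x hx
    rw [Subsingleton.elim (α := ModExt R C N n) y 0, Ext.comp_zero]
  · intro y
    obtain ⟨x, hx⟩ := Ext.contravariant_sequence_exact₁ hS _ y (by omega : 1 + n = n+1)
      (Subsingleton.elim (α := ModExt R C N (n+1)) _ _)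
    exact ⟨x, hx⟩

/-- The first Ext group of `C` from a presentation `0 → A → B → C → 0` with `B` projective. -/
theorem ModExt.exists_connecting (hf : Function.Injective f) (hg : Function.Surjective g)
    (hfg : LinearMap.range f = LinearMap.ker g)
    (k : Type u) [Field k] [Algebra k R]
    [Module.Projective R B] :
    ∃ δ : ModExt R A N 0 →ₗ[k] ModExt R C N 1, Function.Surjective δ ∧
      ∀ φ : A →ₗ[R] N, δ (Ext.mk₀ (ModuleCat.ofHom φ)) = 0 ↔ ∃ ψ : B →ₗ[R] N, ψ.comp f = φ := by
  obtain ⟨w, hS⟩ := exists_shortExact f g hf hg hfg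
  have hB : Projective (ModuleCat.of R B) := inferInstance
  refine ⟨(Ext.bilinearCompOfLinear k (ModuleCat.of R C) (ModuleCat.of R A) (ModuleCat.of R N) 1 0 1
      (by omega)) hS.extClass, ?_, ?_⟩
  · intro y
    obtain ⟨x, hx⟩ := Ext.contravariant_sequence_exact₃ hS _ y
      (Ext.eq_zero_of_projective (P := ModuleCat.of R B) _) (by omega : 1 + 0 = 1)
    exact ⟨x, hx⟩
  · intro φ
    constructor
    · intro h
      obtain ⟨y, hy⟩ := Ext.contravariant_sequence_exact₁ hS (ModuleCat.of R N)
        (Ext.mk₀ (ModuleCat.ofHom φ)) (add_comm 1 0) h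
      obtain ⟨ψ, rfl⟩ := Ext.homEquiv₀.symm.surjective y
      have : Ext.homEquiv₀.symm ψ = Ext.mk₀ ψ := rfl
      rw [this, Ext.mk₀_comp_mk₀] at hy
      have h2 := congrArg ModuleCat.Hom.hom ((Ext.mk₀_bijective _ _).1 hy)
      exact ⟨ψ.hom, h2⟩
    · rintro ⟨ψ, rfl⟩
      change hS.extClass.comp (Ext.mk₀ (ModuleCat.ofHom (ψ.comp f))) (add_zero 1) = 0
      rw [ModuleCat.ofHom_comp, ← Ext.mk₀_comp_mk₀]
      exact hS.extClass_comp_assoc (Ext.mk₀ (ModuleCat.ofHom ψ))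

end ExtSequences

/-- A projective resolution of `M`, in the format used to compute Ext groups. -/
structure IsProjRes {R : Type u} [Ring R] {M : Type u} [AddCommGroup M] [Module R M]
    (P : ℕ → ModuleCat.{u} R) (dif : ∀ n, P (n + 1) →ₗ[R] P n) (aug : P 0 →ₗ[R] M) : Prop where
  proj : ∀ n, Module.Projective R (P n)
  surj : Function.Surjective aug
  exact_zero : LinearMap.ker aug = LinearMap.range (dif 0)
  exact_succ : ∀ n, LinearMap.ker (dif n) = LinearMap.range (dif (n + 1))

section Resolutions

variable {R : Type u} [Ring R] {M : Type u} [AddCommGroup M] [Module R M]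
  {P : ℕ → ModuleCat.{u} R} {dif : ∀ n, P (n + 1) →ₗ[R] P n} {aug : P 0 →ₗ[R] M}

theorem IsProjRes.aug_comp (h : IsProjRes P dif aug) : aug.comp (dif 0) = 0 := by
  exact LinearMap.range_le_ker_iff.1 h.exact_zero.ge

theorem IsProjRes.dif_comp (h : IsProjRes P dif aug) (n : ℕ) :
    (dif n).comp (dif (n + 1)) = 0 := by
  exact LinearMap.range_le_ker_iff.1 (h.exact_succ n).ge

/-- The augmentation of the resolution of the first syzygy. -/
def shiftAug (aug : P 0 →ₗ[R] M) (h : aug.comp (dif 0) = 0) : P 1 →ₗ[R] LinearMap.ker aug :=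
  (dif 0).codRestrict _ fun x => LinearMap.congr_fun h x

theorem IsProjRes.shift (h : IsProjRes P dif aug) :
    IsProjRes (fun n => P (n + 1)) (fun n => dif (n + 1))
      (shiftAug aug h.aug_comp) where
  proj n := h.proj (n + 1)
  surj := by
    rintro ⟨x, hx⟩
    rw [h.exact_zero] at hx
    obtain ⟨y, rfl⟩ := hx
    exact ⟨y, rfl⟩
  exact_zero := by
    rw [← h.exact_succ 0]
    exact LinearMap.ker_codRestrict _ _ _
  exact_succ n := h.exact_succ (n + 1)

theorem exists_factor {A B C N : Type u} [AddCommGroup A] [AddCommGroup B] [AddCommGroup C]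
    [AddCommGroup N] [Module R A] [Module R B] [Module R C] [Module R N]
    (f : A →ₗ[R] B) (g : B →ₗ[R] C) (hg : Function.Surjective g)
    (hfg : LinearMap.ker g = LinearMap.range f) (φ : B →ₗ[R] N) (hφ : φ.comp f = 0) :
    ∃ ψ : C →ₗ[R] N, ψ.comp g = φ := by
  have hle : LinearMap.ker g ≤ LinearMap.ker φ := by
    rw [hfg]; rintro _ ⟨x, rfl⟩; exact LinearMap.congr_fun hφ x
  refine ⟨((LinearMap.ker g).liftQ φ hle).comp (g.quotKerEquivOfSurjective hg).symm.toLinearMap, ?_⟩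
  ext x
  have : (g.quotKerEquivOfSurjective hg).symm (g x) = Submodule.Quotient.mk x := by
    rw [LinearEquiv.symm_apply_eq]; rfl
  simp [this]

variable (k : Type u) [Field k] [Algebra k R]

open CategoryTheory CategoryTheory.Abelian in
/-- Linear maps to the ring as elements of the zeroth Ext group. -/
noncomputable def homLinear (A : Type u) [AddCommGroup A] [Module R A] :
    (A →ₗ[R] R) ≃ₗ[k] ModExt R A R 0 where
  toFun f := Ext.mk₀ (ModuleCat.ofHom f)
  invFun f := (Ext.homEquiv₀ f).hom
  left_inv f := by
    change (Ext.homEquiv₀ (Ext.homEquiv₀.symm (ModuleCat.ofHom f))).hom = f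
    rw [Equiv.apply_symm_apply]; rfl
  right_inv f := Ext.homEquiv₀.symm_apply_apply f
  map_add' f g := Ext.mk₀_add _ _
  map_smul' c f := by
    refine Eq.trans (congrArg Ext.mk₀ ?_) (Ext.mk₀_smul (X := ModuleCat.of R A)
      (Y := ModuleCat.of R R) c (ModuleCat.ofHom f))
    ext x
    exact Algebra.smul_def c (f x)

theorem mem_ker_extδ (n : ℕ) (f : P n →ₗ[R] R) :
    f ∈ LinearMap.ker (extδ k R P dif n) ↔ f.comp (dif n) = 0 := Iff.rfl

/-- Cocycles are maps out of the augmented module. -/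
noncomputable def cocycleEquiv (h : IsProjRes P dif aug) :
    (M →ₗ[R] R) ≃ₗ[k] LinearMap.ker (extδ k R P dif 0) :=
  LinearEquiv.ofBijective
    (LinearMap.codRestrict _
      { toFun := fun f : M →ₗ[R] R => f.comp aug
        map_add' := fun _ _ => rfl
        map_smul' := fun _ _ => rfl }
      (fun f => by
        rw [mem_ker_extδ]
        change (f.comp aug).comp (dif 0) = 0
        rw [LinearMap.comp_assoc, h.aug_comp, LinearMap.comp_zero])) <| by
    constructor
    · intro f g hfg
      have : f.comp aug = g.comp aug := congrArg Subtype.val hfg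
      exact (LinearMap.cancel_right h.surj).1 this
    · rintro ⟨φ, hφ⟩
      obtain ⟨ψ, hψ⟩ := exists_factor (dif 0) aug h.surj h.exact_zero φ hφ
      exact ⟨ψ, Subtype.ext hψ⟩

theorem nonempty_extGrp_zero (h : IsProjRes P dif aug) :
    Nonempty (extGrp k R P dif 0 ≃ₗ[k] ModExt R M R 0) := by
  refine ⟨(Submodule.quotEquivOfEqBot _ ?_).trans ((cocycleEquiv k h).symm.trans
    (homLinear k M))⟩
  rw [eq_bot_iff]
  rintro ⟨x, hx⟩ hx'
  exact Subtype.ext hx'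

theorem nonempty_extGrp_one (h : IsProjRes P dif aug) :
    Nonempty (extGrp k R P dif 1 ≃ₗ[k] ModExt R M R 1) := by
  have := h.proj 0
  obtain ⟨δ, hδ, hδ'⟩ := ModExt.exists_connecting R (LinearMap.ker aug).subtype aug
    (Submodule.injective_subtype _) h.surj (by simp) k
  let β : (LinearMap.ker aug →ₗ[R] R) ≃ₗ[k] LinearMap.ker (extδ k R P dif 1) :=
    cocycleEquiv k h.shift
  let γ : LinearMap.ker (extδ k R P dif 1) →ₗ[k] ModExt R M R 1 :=
    δ.comp ((homLinear k _).toLinearMap.comp β.symm.toLinearMap)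
  have hγ : Function.Surjective γ :=
    hδ.comp ((homLinear k _).surjective.comp β.symm.surjective)
  refine ⟨(Submodule.quotEquivOfEq _ _ ?_).trans (γ.quotKerEquivOfSurjective hγ)⟩
  ext x
  obtain ⟨φ, rfl⟩ := β.surjective x
  have h1 : γ (β φ) = δ (CategoryTheory.Abelian.Ext.mk₀ (ModuleCat.ofHom φ)) := by
    simp only [γ, LinearMap.comp_apply, LinearEquiv.coe_coe, LinearEquiv.symm_apply_apply]; rfl
  have h2 : (β φ : P 1 →ₗ[R] R) = φ.comp (shiftAug aug h.aug_comp) := rfl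
  have h3 : (LinearMap.ker aug).subtype.comp (shiftAug aug h.aug_comp) = dif 0 := rfl
  rw [LinearMap.mem_ker, h1, hδ', Submodule.mem_comap, Submodule.subtype_apply, h2]
  constructor
  · rintro ⟨g, hg⟩
    refine ⟨g, (LinearMap.cancel_right h.shift.surj).1 ?_⟩
    rw [LinearMap.comp_assoc, h3]; exact hg
  · rintro ⟨g, hg⟩
    exact ⟨g, by rw [← hg, LinearMap.comp_assoc, h3]; rfl⟩

/-- The Ext groups of the statement are Mathlib's Ext groups. -/
theorem IsProjRes.nonempty_extGrp (h : IsProjRes P dif aug) (n : ℕ) :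
    Nonempty (extGrp k R P dif n ≃ₗ[k] ModExt R M R n) := by
  match n with
  | 0 => exact nonempty_extGrp_zero k h
  | n + 1 =>
    induction n generalizing M P dif aug with
    | zero => exact nonempty_extGrp_one k h
    | succ n ih =>
      obtain ⟨e⟩ := ih h.shift
      have := h.proj 0
      obtain ⟨e'⟩ := ModExt.nonempty_equiv_shift R (LinearMap.ker aug).subtype aug
        (Submodule.injective_subtype _) h.surj (by simp) k n
      have e0 : extGrp k R P dif (n + 2) ≃ₗ[k]
        extGrp k R (fun n => P (n + 1)) (fun n => dif (n + 1)) (n + 1) := LinearEquiv.refl _ _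
      exact ⟨e0.trans (e.trans e')⟩

/-- Vanishing of Ext in terms of cochains. -/
theorem subsingleton_extGrp_succ_iff (n : ℕ) :
    Subsingleton (extGrp k R P dif (n + 1)) ↔
      ∀ f : P (n + 1) →ₗ[R] R, f.comp (dif (n + 1)) = 0 → ∃ g : P n →ₗ[R] R, g.comp (dif n) = f := by
  refine Submodule.Quotient.subsingleton_iff.trans ?_
  rw [eq_top_iff]
  constructor
  · intro h f hf
    exact h (Submodule.mem_top (x := ⟨f, hf⟩))
  · rintro h ⟨f, hf⟩ -
    exact h f hf

end Resolutions

section InjectiveDimension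

open CategoryTheory CategoryTheory.Abelian

variable {R : Type u} [Ring R] {M N : Type u} [AddCommGroup M] [Module R M]
  [AddCommGroup N] [Module R N]

variable (R M) in
/-- Injective dimension less than `n`, by vanishing of Ext. -/
abbrev InjDimLT (n : ℕ) : Prop := HasInjectiveDimensionLT (ModuleCat.of R M) n

theorem InjDimLT.subsingleton {n : ℕ} (h : InjDimLT R N n) (M : Type u) [AddCommGroup M]
    [Module R M] (i : ℕ) (hi : n ≤ i) : Subsingleton (ModExt R M N i) :=
  HasInjectiveDimensionLT.subsingleton (ModuleCat.of R N) n i hi (ModuleCat.of R M)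

theorem InjDimLT.of_subsingleton (n : ℕ)
    (h : ∀ (M : ModuleCat.{u} R) (i : ℕ), n ≤ i → Subsingleton (ModExt R M N i)) :
    InjDimLT R N n := by
  rw [InjDimLT, hasInjectiveDimensionLT_iff]
  intro i hi Y e
  have := h Y i hi
  exact Subsingleton.elim (α := ModExt R Y N i) e 0

theorem injDimLT_one_iff : InjDimLT R M 1 ↔ Module.Injective R M := by
  rw [Module.injective_iff_injective_object, injective_iff_hasInjectiveDimensionLT_one]

theorem injDimLT_quotient_iff {I : Type u} [AddCommGroup I] [Module R I] [Module.Injective R I]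
    {J : Type u} [AddCommGroup J] [Module R J]
    (f : M →ₗ[R] I) (g : I →ₗ[R] J) (hf : Function.Injective f) (hg : Function.Surjective g)
    (hfg : LinearMap.range f = LinearMap.ker g) (n : ℕ) :
    InjDimLT R J (n + 1) ↔ InjDimLT R M (n + 2) := by
  obtain ⟨w, hS⟩ := exists_shortExact f g hf hg hfg
  exact hS.hasInjectiveDimensionLT_X₃_iff n
    ((Module.injective_iff_injective_object R I).1 inferInstance)

theorem exists_injective_embedding (R : Type u) [Ring R] (M : Type u) [AddCommGroup M]
    [Module R M] : ∃ (I : ModuleCat.{u} R) (f : M →ₗ[R] I), Module.Injective R I ∧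
      Function.Injective f :=
  ⟨Injective.under (ModuleCat.of R M), (Injective.ι (ModuleCat.of R M)).hom,
    (Module.injective_iff_injective_object R _).2
      (inferInstanceAs (Injective (Injective.under (ModuleCat.of R M)))),
    (ModuleCat.mono_iff_injective _).1 inferInstance⟩

theorem injDimLE_iff (n : ℕ) : InjDimLE R n M ↔ InjDimLT R M (n + 1) := by
  induction n generalizing M with
  | zero => exact injDimLT_one_iff.symm
  | succ n ih =>
    constructor
    · rintro (h | ⟨I, f, hI, hf, h⟩)
      · have := injDimLT_one_iff.2 h
        exact hasInjectiveDimensionLT_of_ge _ 1 _ (by omega)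
      · exact (injDimLT_quotient_iff f (LinearMap.range f).mkQ hf
          (Submodule.mkQ_surjective _) (by simp) n).1 (ih.1 h)
    · intro h
      obtain ⟨I, f, hI, hf⟩ := exists_injective_embedding R M
      exact Or.inr ⟨I, f, hI, hf, ih.2 ((injDimLT_quotient_iff f (LinearMap.range f).mkQ hf
          (Submodule.mkQ_surjective _) (by simp) n).2 h)⟩

theorem baer_finsupp [IsNoetherianRing R] (ι : Type u) (h : Module.Baer R M) :
    Module.Baer R (ι →₀ M) := by
  classical
  intro I g
  obtain ⟨S, hS⟩ := IsNoetherian.noetherian (⊤ : Submodule R I)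
  let T : Finset ι := S.biUnion fun x => (g x).support
  have hT : ∀ x : I, g x ∈ Finsupp.supported M R (T : Set ι) := by
    intro x
    have hx : x ∈ Submodule.span R (S : Set I) := hS ▸ Submodule.mem_top
    have : Submodule.span R (S : Set I) ≤ (Finsupp.supported M R (T : Set ι)).comap g := by
      rw [Submodule.span_le]
      intro y hy
      rw [SetLike.mem_coe, Submodule.mem_comap, Finsupp.mem_supported]
      exact_mod_cast Finset.subset_biUnion_of_mem (fun x => (g x).support) hy
    exact this hx
  choose e he using fun t : ι => h I ((Finsupp.lapply t : (ι →₀ M) →ₗ[R] M).comp g)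
  refine ⟨∑ t ∈ T, (Finsupp.lsingle t).comp (e t), fun x hx => ?_⟩
  have h1 := hT ⟨x, hx⟩
  rw [Finsupp.mem_supported] at h1
  simp only [LinearMap.sum_apply, LinearMap.comp_apply, he _ x hx, Finsupp.lapply_apply,
    Finsupp.lsingle_apply]
  rw [← Finsupp.sum_of_support_subset (g ⟨x, hx⟩) (by exact_mod_cast h1) Finsupp.single (by simp)]
  exact Finsupp.sum_single _

theorem InjDimLT.finsupp [IsNoetherianRing R] (ι : Type u) (n : ℕ) (h : InjDimLT R M (n + 1)) :
    InjDimLT R (ι →₀ M) (n + 1) := by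
  have inj {I : Type u} [AddCommGroup I] [Module R I] (h : Module.Injective R I) :
      Module.Injective R (ι →₀ I) :=
    Module.Baer.iff_injective.1 (baer_finsupp ι (Module.Baer.iff_injective.2 h))
  induction n generalizing M with
  | zero => exact injDimLT_one_iff.2 (inj (injDimLT_one_iff.1 h))
  | succ n ih =>
    obtain ⟨I, f, hI, hf⟩ := exists_injective_embedding R M
    have h' := ih ((injDimLT_quotient_iff f (LinearMap.range f).mkQ hf
          (Submodule.mkQ_surjective _) (by simp) n).2 h)
    have := inj hI
    refine (injDimLT_quotient_iff (Finsupp.mapRange.linearMap f)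
      (Finsupp.mapRange.linearMap (LinearMap.range f).mkQ) ?_ ?_ ?_ n).1 h'
    · exact Finsupp.mapRange_injective _ (map_zero f) hf
    · exact Finsupp.mapRange_surjective _ (map_zero _) (Submodule.mkQ_surjective _)
    · rw [Finsupp.range_mapRange_linearMap f (LinearMap.ker_eq_bot.2 hf), Finsupp.ker_mapRange,
        Submodule.ker_mkQ]

theorem InjDimLT.projective [IsNoetherianRing R] (n : ℕ) (h : InjDimLT R R (n + 1))
    (hN : Module.Projective R N) : InjDimLT R N (n + 1) := by
  obtain ⟨s, hs⟩ := (Module.projective_lifting_property (Finsupp.linearCombination R (id : N → N))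
    LinearMap.id (Finsupp.linearCombination_id_surjective R N))
  have := h.finsupp N n
  refine Retract.hasInjectiveDimensionLT (Y := ModuleCat.of R (N →₀ R))
    ⟨ModuleCat.ofHom s, ModuleCat.ofHom (Finsupp.linearCombination R (id : N → N)), ?_⟩ _
  rw [← ModuleCat.ofHom_comp, hs]; rfl

end InjectiveDimension

section Complexes

variable {R : Type u} [Ring R]

/-- The inclusion of `X (i+1) / range` in `X i` for an acyclic complex. -/
def cokerIncl {A B C : Type u} [AddCommGroup A] [AddCommGroup B] [AddCommGroup C]
    [Module R A] [Module R B] [Module R C] (f : A →ₗ[R] B) (g : B →ₗ[R] C)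
    (h : LinearMap.range f = LinearMap.ker g) : (B ⧸ LinearMap.range f) →ₗ[R] C :=
  (LinearMap.range f).liftQ g h.le

section
variable {A B C : Type u} [AddCommGroup A] [AddCommGroup B] [AddCommGroup C]
    [Module R A] [Module R B] [Module R C] (f : A →ₗ[R] B) (g : B →ₗ[R] C)
    (h : LinearMap.range f = LinearMap.ker g)

theorem cokerIncl_injective : Function.Injective (cokerIncl f g h) := by
  rw [← LinearMap.ker_eq_bot]
  exact Submodule.ker_liftQ_eq_bot _ _ _ h.ge

theorem range_cokerIncl : LinearMap.range (cokerIncl f g h) = LinearMap.range g :=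
  Submodule.range_liftQ _ _ _

end

variable {X : ℤ → ModuleCat.{u} R} {d : ∀ i : ℤ, X (i + 1) →ₗ[R] X i}

theorem subsingleton_ext_coker (hp : ∀ i, Module.Projective R (X i))
    (ha : ∀ i, LinearMap.range (d (i + 1)) = LinearMap.ker (d i))
    {N : Type u} [AddCommGroup N] [Module R N] {n : ℕ} (hN : InjDimLT R N n) (m : ℕ) (i : ℤ) :
    Subsingleton (ModExt R (X i ⧸ LinearMap.range (d i)) N (m + 1)) := by
  suffices ∀ r m : ℕ, n ≤ m + r → ∀ i : ℤ,
      Subsingleton (ModExt R (X i ⧸ LinearMap.range (d i)) N (m + 1)) from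
    this n m (by omega) i
  intro r
  induction r with
  | zero => exact fun m hm i => hN.subsingleton _ _ (by omega)
  | succ r ih =>
    intro m hm i
    obtain ⟨j, rfl⟩ : ∃ j, i = j + 1 := ⟨i - 1, by ring⟩
    have := ih (m + 1) (by omega) j
    have := hp j
    have : Subsingleton (ModExt R (X j) N (m + 1)) := ModExt.subsingleton_of_projective N m
    exact ModExt.subsingleton_left N (cokerIncl _ _ (ha j)) (LinearMap.range (d j)).mkQ
      (cokerIncl_injective _ _ _) (Submodule.mkQ_surjective _)
      (by rw [range_cokerIncl, Submodule.ker_mkQ]) (m + 1)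

/-- An acyclic complex of projectives is `Hom(-, N)`-exact if `N` has finite injective
dimension. -/
theorem hom_exact_of_injDimLT (hp : ∀ i, Module.Projective R (X i))
    (ha : ∀ i, LinearMap.range (d (i + 1)) = LinearMap.ker (d i))
    {N : Type u} [AddCommGroup N] [Module R N] {n : ℕ} (hN : InjDimLT R N n) (i : ℤ)
    (f : X (i + 1) →ₗ[R] N) (hf : f.comp (d (i + 1)) = 0) :
    ∃ g : X i →ₗ[R] N, g.comp (d i) = f := by
  have := subsingleton_ext_coker hp ha hN 0 i
  let f' := (LinearMap.range (d (i + 1))).liftQ f (LinearMap.range_le_ker_iff.2 hf)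
  obtain ⟨g, hg⟩ := ModExt.exists_extension N (cokerIncl _ _ (ha i)) (LinearMap.range (d i)).mkQ
      (cokerIncl_injective _ _ _) (Submodule.mkQ_surjective _)
      (by rw [range_cokerIncl, Submodule.ker_mkQ]) f'
  exact ⟨g, by ext x; exact LinearMap.congr_fun hg (Submodule.Quotient.mk x)⟩

end Complexes

section GorensteinProjective

open CategoryTheory.Abelian

variable {R : Type u} [Ring R] {M : Type u} [AddCommGroup M] [Module R M]

theorem ModExt.subsingleton_one_of_extend {A B C : Type u} [AddCommGroup A] [AddCommGroup B]
    [AddCommGroup C] [Module R A] [Module R B] [Module R C] (N : Type u) [AddCommGroup N]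
    [Module R N] (f : A →ₗ[R] B) (g : B →ₗ[R] C) (hf : Function.Injective f)
    (hg : Function.Surjective g) (hfg : LinearMap.range f = LinearMap.ker g)
    [Module.Projective R B] (h : ∀ φ : A →ₗ[R] N, ∃ ψ : B →ₗ[R] N, ψ.comp f = φ) :
    Subsingleton (ModExt R C N 1) := by
  obtain ⟨w, hS⟩ := exists_shortExact f g hf hg hfg
  have hB : CategoryTheory.Projective (ModuleCat.of R B) := inferInstance
  refine subsingleton_of_forall_eq 0 fun y => ?_
  obtain ⟨x, rfl⟩ := Ext.contravariant_sequence_exact₃ hS _ y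
      (Ext.eq_zero_of_projective (P := ModuleCat.of R B) _) (by omega : 1 + 0 = 1)
  obtain ⟨φ, rfl⟩ := Ext.homEquiv₀.symm.surjective x
  obtain ⟨ψ, hψ⟩ := h φ.hom
  have : φ = CategoryTheory.CategoryStruct.comp (ModuleCat.ofHom f) (ModuleCat.ofHom ψ) := by
    rw [← ModuleCat.ofHom_comp, hψ]; rfl
  rw [this]
  change hS.extClass.comp (Ext.mk₀ _) _ = 0
  rw [← Ext.mk₀_comp_mk₀]
  exact hS.extClass_comp_assoc (Ext.mk₀ (ModuleCat.ofHom ψ))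

/-- The projection of an acyclic complex onto its cycles. -/
def toCycles {A B C : Type u} [AddCommGroup A] [AddCommGroup B] [AddCommGroup C]
    [Module R A] [Module R B] [Module R C] (f : A →ₗ[R] B) (g : B →ₗ[R] C)
    (h : LinearMap.range f = LinearMap.ker g) : A →ₗ[R] LinearMap.ker g :=
  f.codRestrict _ fun x => h.le ⟨x, rfl⟩

section
variable {A B C : Type u} [AddCommGroup A] [AddCommGroup B] [AddCommGroup C]
    [Module R A] [Module R B] [Module R C] (f : A →ₗ[R] B) (g : B →ₗ[R] C)
    (h : LinearMap.range f = LinearMap.ker g)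

theorem toCycles_surjective : Function.Surjective (toCycles f g h) := by
  rintro ⟨x, hx⟩
  obtain ⟨y, rfl⟩ := h.ge hx
  exact ⟨y, rfl⟩

theorem ker_toCycles : LinearMap.ker (toCycles f g h) = LinearMap.ker f :=
  LinearMap.ker_codRestrict _ _ _

end

theorem IsGorensteinProjective.subsingleton_ext (hM : IsGorensteinProjective R M)
    (Q : ModuleCat.{u} R) (hQ : Module.Projective R Q) (m : ℕ) :
    Subsingleton (ModExt R M Q (m + 1)) := by
  obtain ⟨P, d, hp, ha, hh, ⟨e⟩⟩ := hM
  suffices ∀ i : ℤ, Subsingleton (ModExt R (LinearMap.ker (d i)) Q (m + 1)) by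
    have := this 0
    exact ModExt.subsingleton_congr Q e _
  induction m with
  | zero =>
    intro i
    have := hp (i + 1 + 1)
    refine ModExt.subsingleton_one_of_extend Q (LinearMap.ker (d (i + 1))).subtype
      (toCycles (d (i + 1)) (d i) (ha i)) (Submodule.injective_subtype _)
      (toCycles_surjective _ _ _) (by rw [Submodule.range_subtype, ker_toCycles]) fun φ => ?_
    obtain ⟨g, hg⟩ := hh Q hQ (i + 1 + 1)
      (φ.comp (toCycles (d (i + 1 + 1)) (d (i + 1)) (ha _))) (by
        have h0 : (toCycles (d (i + 1 + 1)) (d (i + 1)) (ha _)).comp (d (i + 1 + 1 + 1)) = 0 :=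
          LinearMap.range_le_ker_iff.1 (by rw [ker_toCycles]; exact (ha (i + 1 + 1)).le)
        rw [LinearMap.comp_assoc, h0, LinearMap.comp_zero])
    refine ⟨g, (LinearMap.cancel_right (toCycles_surjective _ _ (ha (i + 1)))).1 ?_⟩
    rw [← hg]; rfl
  | succ m ih =>
    intro i
    have := ih (i + 1)
    have := hp (i + 1 + 1)
    have := ModExt.subsingleton_of_projective (R := R) (A := P (i + 1 + 1)) Q (m + 1)
    exact ModExt.subsingleton_right Q (LinearMap.ker (d (i + 1))).subtype
      (toCycles (d (i + 1)) (d i) (ha i)) (Submodule.injective_subtype _)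
      (toCycles_surjective _ _ _) (by rw [Submodule.range_subtype, ker_toCycles]) (m + 1)

theorem GProjDimLE.subsingleton_ext {n : ℕ} (hM : GProjDimLE R n M) (i : ℕ) (hi : n < i) :
    Subsingleton (ModExt R M R i) := by
  obtain ⟨i, rfl⟩ : ∃ j, i = j + 1 := ⟨i - 1, by omega⟩
  induction n generalizing M i with
  | zero => exact IsGorensteinProjective.subsingleton_ext hM (ModuleCat.of R R) inferInstance i
  | succ n ih =>
    rcases hM with h | ⟨G, f, hG, hf, h⟩
    · exact h.subsingleton_ext (ModuleCat.of R R) inferInstance i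
    · obtain ⟨i, rfl⟩ : ∃ j, i = j + 1 := ⟨i - 1, by omega⟩
      have := ih h i (by omega)
      have : Subsingleton (ModExt R G R (i + 1 + 1)) :=
        hG.subsingleton_ext (ModuleCat.of R R) inferInstance _
      exact ModExt.subsingleton_right R (LinearMap.ker f).subtype f
        (Submodule.injective_subtype _) hf (by simp) (i + 1)

theorem exists_injDimLT_of_lGgldim (h : lGgldim R < ⊤) : ∃ n : ℕ, InjDimLT R R (n + 1) := by
  obtain ⟨n, hn⟩ := ENat.ne_top_iff_exists.1 h.ne
  refine ⟨n, InjDimLT.of_subsingleton _ fun M i hi => ?_⟩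
  have h1 : gProjDim R M ≤ n := by
    rw [hn]; exact le_iSup (fun M : ModuleCat.{u} R => gProjDim R M) M
  have h2 : gProjDim R M < ((n + 1 : ℕ) : ℕ∞) := lt_of_le_of_lt h1 (by exact_mod_cast Nat.lt_succ_self n)
  obtain ⟨_, ⟨m, rfl, hm⟩, hlt⟩ := sInf_lt_iff.1 h2
  have : m < n + 1 := by exact_mod_cast hlt
  exact hm.subsingleton_ext i (by omega)

theorem IsGorensteinProjective.congr {N : Type u} [AddCommGroup N] [Module R N] (e : M ≃ₗ[R] N)
    (h : IsGorensteinProjective R M) : IsGorensteinProjective R N := by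
  obtain ⟨P, d, hp, ha, hh, ⟨e'⟩⟩ := h
  exact ⟨P, d, hp, ha, hh, ⟨e.symm.trans e'⟩⟩

theorem IsGorensteinProjective.of_projective (h : Module.Projective R M) :
    IsGorensteinProjective R M := by
  refine ⟨fun _ => ModuleCat.of R (M × M),
    fun _ => (LinearMap.inl R M M).comp (LinearMap.snd R M M), fun _ => inferInstance, ?_, ?_, ?_⟩
  · intro i
    ext ⟨x, y⟩
    constructor
    · rintro ⟨⟨a, b⟩, hab⟩
      have h2 : (0 : M) = y := congrArg Prod.snd hab
      change ((y, 0) : M × M) = 0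
      rw [← h2]; rfl
    · intro hxy
      have h1 : y = 0 := congrArg Prod.fst (a₁ := ((y, 0) : M × M)) (a₂ := 0) hxy
      exact ⟨((0, x) : M × M), by subst h1; rfl⟩
  · intro Q hQ i f hf
    refine ⟨f.comp ((LinearMap.inr R M M).comp (LinearMap.fst R M M)), ?_⟩
    refine LinearMap.ext fun ⟨x, y⟩ => ?_
    have h1 : f ((x, 0) : M × M) = 0 := LinearMap.congr_fun hf ((0, x) : M × M)
    change f ((0, y) : M × M) = f ((x, y) : M × M)
    have h2 : ((x, y) : M × M) = (x, 0) + (0, y) := by simp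
    rw [h2]
    exact (by rw [h1, zero_add] : f ((0, y) : M × M) = f ((x, 0) : M × M) + f ((0, y) : M × M)).trans
      (map_add f _ _).symm
  · refine ⟨LinearEquiv.ofBijective (LinearMap.codRestrict _ (LinearMap.inl R M M) fun x => rfl) ⟨?_, ?_⟩⟩
    · intro x y hxy
      exact congrArg Prod.fst (congrArg Subtype.val hxy)
    · rintro ⟨⟨x, y⟩, hxy⟩
      have h1 : y = 0 := congrArg Prod.fst (a₁ := ((y, 0) : M × M)) (a₂ := 0) hxy
      exact ⟨x, Subtype.ext (by subst h1; rfl)⟩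

theorem gProjDimLE_of_syzygy {P : ℕ → ModuleCat.{u} R} {dif : ∀ n, P (n + 1) →ₗ[R] P n}
    {aug : P 0 →ₗ[R] M} (h : IsProjRes P dif aug) (d : ℕ)
    (hd : IsGorensteinProjective R (LinearMap.ker (dif d))) : GProjDimLE R (d + 2) M := by
  induction d generalizing M P dif aug with
  | zero =>
    refine Or.inr ⟨P 0, aug, .of_projective (h.proj 0), h.surj, Or.inr
      ⟨P 1, _, .of_projective (h.proj 1), h.shift.surj, ?_⟩⟩
    exact hd.congr (LinearEquiv.ofEq _ _ (LinearMap.ker_codRestrict _ _ _).symm)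
  | succ d ih => exact Or.inr ⟨P 0, aug, .of_projective (h.proj 0), h.surj, ih h.shift hd⟩

end GorensteinProjective

section FreeResolution

variable {R : Type u} [Ring R]

theorem exists_fin_cover (M : Type u) [AddCommGroup M] [Module R M] [Module.Finite R M] :
    ∃ (n : ℕ) (f : (Fin n → R) →ₗ[R] M), Function.Surjective f :=
  Module.Finite.exists_fin' R M

variable [IsNoetherianRing R]

/-- The next syzygy in a finitely generated free resolution. -/
noncomputable def nextSyzygy (K : Σ n : ℕ, Submodule R (Fin n → R)) :
    Σ n : ℕ, Submodule R (Fin n → R) :=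
  ⟨(exists_fin_cover (R := R) K.2).choose,
    LinearMap.ker (exists_fin_cover (R := R) K.2).choose_spec.choose⟩

/-- The iterated syzygies in a finitely generated free resolution. -/
noncomputable def iterSyzygy (K : Σ n : ℕ, Submodule R (Fin n → R)) :
    ℕ → Σ n : ℕ, Submodule R (Fin n → R)
  | 0 => K
  | n + 1 => nextSyzygy (iterSyzygy K n)

theorem exists_free_resolution (M : Type u) [AddCommGroup M] [Module R M] [Module.Finite R M] :
    ∃ (m : ℕ → ℕ) (φ : ∀ n, (Fin (m (n + 1)) → R) →ₗ[R] (Fin (m n) → R))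
      (aug : (Fin (m 0) → R) →ₗ[R] M),
      IsProjRes (P := fun n => ModuleCat.of R (Fin (m n) → R)) φ aug := by
  obtain ⟨m₀, aug, haug⟩ := exists_fin_cover (R := R) M
  let K := iterSyzygy ⟨m₀, LinearMap.ker aug⟩
  let π (n : ℕ) : (Fin (K (n + 1)).1 → R) →ₗ[R] (K n).2 :=
    (exists_fin_cover (R := R) (K n).2).choose_spec.choose
  have hπ (n : ℕ) : Function.Surjective (π n) :=
    (exists_fin_cover (R := R) (K n).2).choose_spec.choose_spec
  have hK (n : ℕ) : (K (n + 1)).2 = LinearMap.ker (π n) := rfl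
  have hr (n : ℕ) : LinearMap.range ((K n).2.subtype.comp (π n)) = (K n).2 := by
    rw [LinearMap.range_comp, LinearMap.range_eq_top.2 (hπ n), Submodule.map_top,
      Submodule.range_subtype]
  have hk (n : ℕ) : LinearMap.ker ((K n).2.subtype.comp (π n)) = (K (n + 1)).2 := by
    rw [hK, LinearMap.ker_comp_of_ker_eq_bot _ (Submodule.ker_subtype _)]
  refine ⟨fun n => (K n).1, fun n => (K n).2.subtype.comp (π n), aug,
    ⟨fun n => inferInstance, haug, (hr 0).symm, fun n => (hk n).trans (hr (n + 1)).symm⟩⟩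

end FreeResolution

section Duality

variable {k R : Type u} [Field k] [Ring R] [Algebra k R]

/-- The transpose of a map of free modules, twisted by a map of the ring to itself. -/
def twistDual {m n : ℕ} (s : R → R) (φ : (Fin m → R) →ₗ[R] (Fin n → R)) :
    (Fin n → R) →ₗ[R] (Fin m → R) :=
  LinearMap.pi fun i => ∑ j, (LinearMap.proj j : (Fin n → R) →ₗ[R] R).smulRight
    (s (φ (Pi.single i 1) j))

theorem twistDual_apply {m n : ℕ} (s : R → R) (φ : (Fin m → R) →ₗ[R] (Fin n → R))
    (v : Fin n → R) (i : Fin m) :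
    twistDual s φ v i = ∑ j, v j * s (φ (Pi.single i 1) j) := by
  simp [twistDual]

theorem map_eq_sum_single {m : ℕ} {N : Type*} [AddCommGroup N] [Module R N]
    (φ : (Fin m → R) →ₗ[R] N) (x : Fin m → R) : φ x = ∑ i, x i • φ (Pi.single i 1) := by
  conv_lhs => rw [← Finset.univ_sum_single x]
  rw [map_sum]
  refine Finset.sum_congr rfl fun i _ => ?_
  rw [← map_smul, ← Pi.single_smul, smul_eq_mul, mul_one]

theorem twistDual_twistDual {m n : ℕ} (s t : R → R) (hts : ∀ x, t (s x) = x)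
    (φ : (Fin m → R) →ₗ[R] (Fin n → R)) : twistDual t (twistDual s φ) = φ := by
  refine LinearMap.ext fun x => funext fun j => ?_
  rw [twistDual_apply, map_eq_sum_single φ, Finset.sum_apply]
  refine Finset.sum_congr rfl fun i _ => ?_
  rw [twistDual_apply, Finset.sum_eq_single j]
  · simp [hts]
  · intro b _ hb
    simp [hb]
  · simp

/-- The dual of a free module, identified with the free module through an antiautomorphism. -/
noncomputable def dualEquiv (s : R ≃ₗ[k] R) (n : ℕ) : ((Fin n → R) →ₗ[R] R) ≃ₗ[k] (Fin n → R) :=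
  ((Pi.basisFun R (Fin n)).constr k).symm.trans (LinearEquiv.piCongrRight fun _ => s)

theorem dualEquiv_apply (s : R ≃ₗ[k] R) {n : ℕ} (f : (Fin n → R) →ₗ[R] R) (i : Fin n) :
    dualEquiv s n f i = s (f (Pi.single i 1)) := by
  simp [dualEquiv, Module.Basis.constr]

theorem dualEquiv_comp (s : R ≃ₗ[k] R) (hs : ∀ a b, s (a * b) = s b * s a) {m n : ℕ}
    (φ : (Fin m → R) →ₗ[R] (Fin n → R)) (f : (Fin n → R) →ₗ[R] R) :
    dualEquiv s m (f.comp φ) = twistDual s φ (dualEquiv s n f) := by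
  ext i
  rw [dualEquiv_apply, twistDual_apply, LinearMap.comp_apply, map_eq_sum_single f, map_sum]
  refine Finset.sum_congr rfl fun j _ => ?_
  rw [dualEquiv_apply, smul_eq_mul, hs]

theorem range_twistDual_eq_ker (s : R ≃ₗ[k] R) (hs : ∀ a b, s (a * b) = s b * s a) {l m n : ℕ}
    (ψ : (Fin l → R) →ₗ[R] (Fin m → R)) (χ : (Fin m → R) →ₗ[R] (Fin n → R))
    (h0 : χ.comp ψ = 0)
    (h : ∀ f : (Fin m → R) →ₗ[R] R, f.comp ψ = 0 → ∃ g : (Fin n → R) →ₗ[R] R, g.comp χ = f) :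
    LinearMap.range (twistDual s χ) = LinearMap.ker (twistDual s ψ) := by
  apply le_antisymm
  · rintro _ ⟨v, rfl⟩
    obtain ⟨f, rfl⟩ := (dualEquiv s n).surjective v
    rw [LinearMap.mem_ker, ← dualEquiv_comp s hs, ← dualEquiv_comp s hs, LinearMap.comp_assoc, h0,
      LinearMap.comp_zero, map_zero]
  · intro v hv
    obtain ⟨f, rfl⟩ := (dualEquiv s m).surjective v
    rw [LinearMap.mem_ker, ← dualEquiv_comp s hs, (dualEquiv s l).map_eq_zero_iff] at hv
    obtain ⟨g, rfl⟩ := h f hv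
    exact ⟨dualEquiv s n g, (dualEquiv_comp s hs _ _).symm⟩

theorem antiaut_symm (s : R ≃ₗ[k] R) (hs : ∀ a b, s (a * b) = s b * s a) (a b : R) :
    s.symm (a * b) = s.symm b * s.symm a := by
  rw [LinearEquiv.symm_apply_eq, hs, LinearEquiv.apply_symm_apply, LinearEquiv.apply_symm_apply]

end Duality

section Glue

variable {R : Type u} [Ring R]

/-- The terms of the complex glued from two half-infinite ones. -/
def glueObj (A B : ℕ → ModuleCat.{u} R) : ℤ → ModuleCat.{u} R
  | .ofNat n => A n
  | .negSucc n => B n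

/-- The maps of the complex glued from two half-infinite ones. -/
def glueMap (A B : ℕ → ModuleCat.{u} R) (α : ∀ n, A (n + 1) →ₗ[R] A n) (γ : A 0 →ₗ[R] B 0)
    (β : ∀ n, B n →ₗ[R] B (n + 1)) : ∀ i : ℤ, glueObj A B (i + 1) →ₗ[R] glueObj A B i
  | .ofNat n => α n
  | .negSucc 0 => γ
  | .negSucc (n + 1) => β n

variable {A B : ℕ → ModuleCat.{u} R} {α : ∀ n, A (n + 1) →ₗ[R] A n} {γ : A 0 →ₗ[R] B 0}
  {β : ∀ n, B n →ₗ[R] B (n + 1)}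

theorem glue_projective (hA : ∀ n, Module.Projective R (A n)) (hB : ∀ n, Module.Projective R (B n))
    (i : ℤ) : Module.Projective R (glueObj A B i) :=
  match i with
  | .ofNat n => hA n
  | .negSucc n => hB n

theorem glue_acyclic (h1 : ∀ n, LinearMap.range (α (n + 1)) = LinearMap.ker (α n))
    (h2 : LinearMap.range (α 0) = LinearMap.ker γ) (h3 : LinearMap.range γ = LinearMap.ker (β 0))
    (h4 : ∀ n, LinearMap.range (β n) = LinearMap.ker (β (n + 1))) (i : ℤ) :
    LinearMap.range (glueMap A B α γ β (i + 1)) = LinearMap.ker (glueMap A B α γ β i) :=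
  match i with
  | .ofNat n => h1 n
  | .negSucc 0 => h2
  | .negSucc 1 => h3
  | .negSucc (n + 2) => h4 n

end Glue

section CompleteResolution

variable {k R : Type u} [Field k] [Ring R] [Algebra k R] [IsNoetherianRing R]

/-- A free resolution whose dual is exact extends to an acyclic complex of projectives. -/
theorem exists_complete_resolution (s : R ≃ₗ[k] R) (hs : ∀ a b, s (a * b) = s b * s a)
    {n₀ : ℕ} (hR : InjDimLT R R n₀) (m : ℕ → ℕ)
    (φ : ∀ n, (Fin (m (n + 1)) → R) →ₗ[R] (Fin (m n) → R))
    (hφ : ∀ n, LinearMap.range (φ (n + 1)) = LinearMap.ker (φ n))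
    (hφ' : ∀ n, LinearMap.range (twistDual s (φ n)) = LinearMap.ker (twistDual s (φ (n + 1)))) :
    ∃ (B : ℕ → ModuleCat.{u} R) (γ : (Fin (m 0) → R) →ₗ[R] B 0) (β : ∀ n, B n →ₗ[R] B (n + 1)),
      (∀ n, Module.Projective R (B n)) ∧
      ∀ i, LinearMap.range (glueMap (fun n => ModuleCat.of R (Fin (m n) → R)) B φ γ β (i + 1)) =
        LinearMap.ker (glueMap (fun n => ModuleCat.of R (Fin (m n) → R)) B φ γ β i) := by
  obtain ⟨q, ρ, aug, hq⟩ := exists_free_resolution (R := R) (LinearMap.ker (twistDual s (φ 0)))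
  let γ' : (Fin (q 0) → R) →ₗ[R] (Fin (m 0) → R) := (Submodule.subtype _).comp aug
  have hγ1 : LinearMap.range γ' = LinearMap.ker (twistDual s (φ 0)) := by
    rw [LinearMap.range_comp, LinearMap.range_eq_top.2 hq.surj, Submodule.map_top,
      Submodule.range_subtype]
  have hγ2 : LinearMap.range (ρ 0) = LinearMap.ker γ' := by
    rw [LinearMap.ker_comp_of_ker_eq_bot _ (Submodule.ker_subtype _)]
    exact hq.exact_zero.symm
  have hρ n : LinearMap.range (ρ (n + 1)) = LinearMap.ker (ρ n) := (hq.exact_succ n).symm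
  have hT := hom_exact_of_injDimLT
    (glue_projective (A := fun n => ModuleCat.of R (Fin (q n) → R))
      (B := fun n => ModuleCat.of R (Fin (m n) → R)) hq.proj (fun n => inferInstance))
    (glue_acyclic (α := ρ) (γ := γ') (β := fun n => twistDual s (φ n)) hρ hγ2 hγ1 hφ') hR
  have hs' := antiaut_symm s hs
  refine ⟨fun n => ModuleCat.of R (Fin (q n) → R), twistDual s.symm γ',
    fun n => twistDual s.symm (ρ n), fun n => inferInstance, glue_acyclic hφ ?_ ?_ ?_⟩
  · have := range_twistDual_eq_ker s.symm hs' γ' (twistDual s (φ 0))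
      (LinearMap.range_le_ker_iff.1 hγ1.le) (hT (.negSucc 1))
    rwa [twistDual_twistDual _ _ s.symm_apply_apply] at this
  · exact range_twistDual_eq_ker s.symm hs' (ρ 0) γ' (LinearMap.range_le_ker_iff.1 hγ2.le)
      (hT (.negSucc 0))
  · exact fun n => range_twistDual_eq_ker s.symm hs' (ρ (n + 1)) (ρ n)
      (LinearMap.range_le_ker_iff.1 (hρ n).le) (hT (.ofNat n))

end CompleteResolution

section Cochains

variable {R : Type u} [Ring R] {m : ℕ → ℕ}

/-- The coboundaries of a cochain complex of free modules. -/
def coboundaries (δ : ∀ n, (Fin (m n) → R) →ₗ[R] (Fin (m (n + 1)) → R)) :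
    ∀ j, Submodule R (Fin (m j) → R)
  | 0 => ⊥
  | j + 1 => LinearMap.range (δ j)

variable {δ : ∀ n, (Fin (m n) → R) →ₗ[R] (Fin (m (n + 1)) → R)}

theorem coboundaries_le (hδ : ∀ n, (δ (n + 1)).comp (δ n) = 0) (j : ℕ) :
    coboundaries δ j ≤ LinearMap.ker (δ j) := by
  cases j with
  | zero => exact bot_le
  | succ j => exact LinearMap.range_le_ker_iff.2 (hδ j)

/-- The map induced by the differential on cochains modulo coboundaries. -/
def cokernelMap (hδ : ∀ n, (δ (n + 1)).comp (δ n) = 0) (j : ℕ) :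
    ((Fin (m j) → R) ⧸ coboundaries δ j) →ₗ[R] (Fin (m (j + 1)) → R) :=
  (coboundaries δ j).liftQ (δ j) (coboundaries_le hδ j)

/-- The cohomology of a cochain complex of free modules. -/
abbrev cohomology (hδ : ∀ n, (δ (n + 1)).comp (δ n) = 0) (j : ℕ) :
    Submodule R ((Fin (m j) → R) ⧸ coboundaries δ j) :=
  LinearMap.ker (cokernelMap hδ j)

variable (hδ : ∀ n, (δ (n + 1)).comp (δ n) = 0)

theorem range_cokernelMap (j : ℕ) :
    LinearMap.range (cokernelMap hδ j) = coboundaries δ (j + 1) :=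
  Submodule.range_liftQ _ _ _

theorem cokernelMap_injective (j : ℕ) [Subsingleton (cohomology hδ j)] :
    Function.Injective (cokernelMap hδ j) := by
  rw [← LinearMap.ker_eq_bot]
  exact (Submodule.subsingleton_iff_eq_bot).1 ‹_›

/-- The corestriction of the induced map to the coboundaries. -/
def toCoboundaries (j : ℕ) :
    ((Fin (m j) → R) ⧸ coboundaries δ j) →ₗ[R] coboundaries δ (j + 1) :=
  (cokernelMap hδ j).codRestrict _ fun x => (range_cokernelMap hδ j).le ⟨x, rfl⟩

theorem toCoboundaries_surjective (j : ℕ) : Function.Surjective (toCoboundaries hδ j) := by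
  rintro ⟨x, hx⟩
  obtain ⟨y, rfl⟩ := (range_cokernelMap hδ j).ge hx
  exact ⟨y, rfl⟩

theorem cohomology_exact (j : ℕ) : LinearMap.range (cohomology hδ j).subtype =
    LinearMap.ker (toCoboundaries hδ j) := by
  rw [Submodule.range_subtype]
  exact (LinearMap.ker_codRestrict _ _ _).symm

theorem subsingleton_ext_coboundaries {n₀ : ℕ} (hR : InjDimLT R R n₀) (t : ℕ)
    (h : ∀ i q, t < q → Subsingleton (ModExt R (cohomology hδ i) R q)) (q : ℕ) (hq : t ≤ q)
    (hq' : 1 ≤ q) (j : ℕ) : Subsingleton (ModExt R (coboundaries δ j) R q) := by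
  suffices ∀ r q : ℕ, t ≤ q → 1 ≤ q → n₀ ≤ q + r → ∀ j : ℕ,
      Subsingleton (ModExt R (coboundaries δ j) R q) from this n₀ q hq hq' (by omega) j
  intro r
  induction r with
  | zero => exact fun q _ _ hq j => hR.subsingleton _ _ hq
  | succ r ih =>
    intro q hq hq' hn j
    obtain ⟨q, rfl⟩ : ∃ p, q = p + 1 := ⟨q - 1, by omega⟩
    have := ih (q + 1 + 1) (by omega) (by omega) (by omega) (j + 1)
    have := h j (q + 1 + 1) (by omega)
    have := ModExt.subsingleton_mid R _ _ (Submodule.injective_subtype _)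
      (toCoboundaries_surjective hδ j) (cohomology_exact hδ j) (q + 1 + 1)
    have := ModExt.subsingleton_of_projective (R := R) (A := Fin (m j) → R) R q
    exact ModExt.subsingleton_left R (coboundaries δ j).subtype (coboundaries δ j).mkQ
      (Submodule.injective_subtype _) (Submodule.mkQ_surjective _) (by simp) (q + 1)

theorem subsingleton_ext_cokernel_succ {n₀ : ℕ} (hR : InjDimLT R R n₀) (t : ℕ)
    (h : ∀ i q, t < q → Subsingleton (ModExt R (cohomology hδ i) R q)) (q : ℕ) (hq : t ≤ q)
    (hq' : 1 ≤ q) (j : ℕ) [Subsingleton (ModExt R (cohomology hδ j) R q)] :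
    Subsingleton (ModExt R ((Fin (m j) → R) ⧸ coboundaries δ j) R q) := by
  have := subsingleton_ext_coboundaries hδ hR t h q hq hq' (j + 1)
  exact ModExt.subsingleton_mid R _ _ (Submodule.injective_subtype _)
    (toCoboundaries_surjective hδ j) (cohomology_exact hδ j) q

theorem subsingleton_ext_cokernel (s : ℕ) (h : ∀ j < s, Subsingleton (cohomology hδ j)) (j q : ℕ)
    (hj : j ≤ s) (hq : j < q) :
    Subsingleton (ModExt R ((Fin (m j) → R) ⧸ coboundaries δ j) R q) := by
  induction j generalizing q with
  | zero =>
    obtain ⟨q, rfl⟩ : ∃ p, q = p + 1 := ⟨q - 1, by omega⟩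
    have := ModExt.subsingleton_of_projective (R := R) (A := Fin (m 0) → R) R q
    exact ModExt.subsingleton_congr R (Submodule.quotEquivOfEqBot (coboundaries δ 0) rfl) (q + 1)
  | succ j ih =>
    obtain ⟨q, rfl⟩ : ∃ p, q = p + 1 + 1 := ⟨q - 2, by omega⟩
    have := ih (q + 1) (by omega) (by omega)
    have := h j (by omega)
    have := ModExt.subsingleton_of_projective (R := R) (A := Fin (m (j + 1)) → R) R (q + 1)
    exact ModExt.subsingleton_right R (cokernelMap hδ j) (coboundaries δ (j + 1)).mkQ
      (cokernelMap_injective hδ j) (Submodule.mkQ_surjective _)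
      (by rw [range_cokernelMap, Submodule.ker_mkQ]) (q + 1)

theorem nonempty_ext_cokernel_equiv (k : Type u) [Field k] [Algebra k R] (s : ℕ)
    (h : ∀ j < s, Subsingleton (cohomology hδ j)) (j : ℕ) (hj : j + 1 ≤ s) :
    Nonempty (ModExt R ((Fin (m 1) → R) ⧸ coboundaries δ 1) R 1 ≃ₗ[k]
      ModExt R ((Fin (m (j + 1)) → R) ⧸ coboundaries δ (j + 1)) R (j + 1)) := by
  induction j with
  | zero => exact ⟨LinearEquiv.refl _ _⟩
  | succ j ih =>
    obtain ⟨e⟩ := ih (by omega)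
    have := h (j + 1) (by omega)
    obtain ⟨e'⟩ := ModExt.nonempty_equiv_shift R (cokernelMap hδ (j + 1))
      (coboundaries δ (j + 1 + 1)).mkQ
      (cokernelMap_injective hδ _) (Submodule.mkQ_surjective _)
      (by rw [range_cokernelMap, Submodule.ker_mkQ]) k j
    exact ⟨e.trans e'⟩

theorem extend_of_ext_cokernel_one [Subsingleton (ModExt R ((Fin (m 1) → R) ⧸ coboundaries δ 1) R 1)]
    (f : (Fin (m 0) → R) →ₗ[R] R) (hf : LinearMap.ker (δ 0) ≤ LinearMap.ker f) :
    ∃ g : (Fin (m 1) → R) →ₗ[R] R, g.comp (δ 0) = f := by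
  obtain ⟨ψ, hψ⟩ := exists_factor (LinearMap.ker (δ 0)).subtype (δ 0).rangeRestrict
    (δ 0).surjective_rangeRestrict (by simp) f (by ext x; exact hf x.2)
  obtain ⟨g, hg⟩ := ModExt.exists_extension R (coboundaries δ 1).subtype (coboundaries δ 1).mkQ
    (Submodule.injective_subtype _) (Submodule.mkQ_surjective _) (by simp) ψ
  refine ⟨g, ?_⟩
  rw [← hψ, ← hg]
  rfl

end Cochains

section Corner

variable {k R : Type u} [Field k] [Ring R] [Algebra k R]

/-- The complex of twisted transposes of a complex of free modules. -/
abbrev twistComplex (s : R → R) {m : ℕ → ℕ}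
    (φ : ∀ n, (Fin (m (n + 1)) → R) →ₗ[R] (Fin (m n) → R)) (n : ℕ) :
    (Fin (m n) → R) →ₗ[R] (Fin (m (n + 1)) → R) :=
  twistDual s (φ n)

theorem nonempty_equiv_of_presentation (s : R ≃ₗ[k] R) (hs : ∀ a b, s (a * b) = s b * s a)
    {M Z : Type u} [AddCommGroup M] [Module k M] [Module R M] [IsScalarTower k R M]
    [AddCommGroup Z] [Module k Z] {p q : ℕ} (φ : (Fin q → R) →ₗ[R] (Fin p → R))
    (aug : (Fin p → R) →ₗ[R] M) (haug : Function.Surjective aug)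
    (hφ : LinearMap.ker aug = LinearMap.range φ)
    (Θ : ((Fin p → R) →ₗ[R] R) →ₗ[k] Z) (hΘ : Function.Surjective Θ)
    (hΘ' : ∀ f, Θ f = 0 ↔ ∃ g : (Fin q → R) →ₗ[R] R, g.comp (twistDual s φ) = f) :
    Nonempty (Z ≃ₗ[k] M) := by
  let a : (Fin p → R) →ₗ[k] M := aug.restrictScalars k
  let D := dualEquiv s.symm p
  let b : (Fin p → R) →ₗ[k] Z := Θ.comp D.symm.toLinearMap
  have hb : Function.Surjective b := hΘ.comp D.symm.surjective
  have hker : LinearMap.ker b = LinearMap.ker a := by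
    ext v
    obtain ⟨f, rfl⟩ := D.surjective v
    have h1 : D f ∈ LinearMap.ker a ↔ D f ∈ LinearMap.ker aug := Iff.rfl
    have h2 : b (D f) = Θ f := by simp [b]
    rw [LinearMap.mem_ker, h1, h2, hΘ', hφ]
    have key (g : (Fin q → R) →ₗ[R] R) : D (g.comp (twistDual s φ)) = φ (dualEquiv s.symm q g) := by
      rw [dualEquiv_comp s.symm (antiaut_symm s hs), twistDual_twistDual _ _ s.symm_apply_apply]
    constructor
    · rintro ⟨g, rfl⟩
      exact ⟨_, (key g).symm⟩
    · rintro ⟨w, hw⟩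
      obtain ⟨g, rfl⟩ := (dualEquiv s.symm q).surjective w
      exact ⟨g, D.injective ((key g).trans hw)⟩
  exact ⟨(b.quotKerEquivOfSurjective hb).symm.trans
    ((Submodule.quotEquivOfEq _ _ hker).trans (a.quotKerEquivOfSurjective haug))⟩

/-- If the Ext groups of the cohomology modules are multiplicative in dimension, the cohomology
is one-dimensional and concentrated in a single degree. -/
theorem exists_unique_cohomology (s : R ≃ₗ[k] R) (hs : ∀ a b, s (a * b) = s b * s a)
    {n₀ : ℕ} (hR : InjDimLT R R n₀)
    {M : Type u} [AddCommGroup M] [Module k M] [Module R M] [IsScalarTower k R M]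
    (hM : Module.finrank k M = 1) {m : ℕ → ℕ}
    {φ : ∀ n, (Fin (m (n + 1)) → R) →ₗ[R] (Fin (m n) → R)} {aug : (Fin (m 0) → R) →ₗ[R] M}
    (h : IsProjRes (P := fun n => ModuleCat.of R (Fin (m n) → R)) φ aug)
    (hδ : ∀ n, (twistComplex s φ (n + 1)).comp (twistComplex s φ n) = 0) (e : ℕ → ℕ)
    (he : ∀ j, e j = 0 → Subsingleton (cohomology hδ j))
    (hX : ∀ j q, Nonempty (ModExt R (cohomology hδ j) R q ≃ₗ[k] (Fin (e j * e q) → k))) :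
    ∃ d, e d = 1 ∧ ∀ i, i ≠ d → e i = 0 := by
  have hX0 (j q : ℕ) (hjq : e j * e q = 0) : Subsingleton (ModExt R (cohomology hδ j) R q) := by
    obtain ⟨E⟩ := hX j q
    have : IsEmpty (Fin (e j * e q)) := by rw [hjq]; infer_instance
    exact E.toEquiv.subsingleton
  have hX1 (j q : ℕ) [Subsingleton (ModExt R (cohomology hδ j) R q)] : e j * e q = 0 := by
    obtain ⟨E⟩ := hX j q
    have : Subsingleton (Fin (e j * e q) → k) := E.symm.toEquiv.subsingleton
    have := Module.finrank_zero_of_subsingleton (R := k) (M := Fin (e j * e q) → k)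
    simpa using this
  have hn (q : ℕ) (hq : n₀ ≤ q) : e q = 0 := by
    have := hR.subsingleton (cohomology hδ q) q hq
    exact mul_self_eq_zero.1 (hX1 q q)
  have hW0 [Subsingleton (cohomology hδ 0)] : Nonempty (ModExt R
      ((Fin (m 1) → R) ⧸ coboundaries (twistComplex s φ) 1) R 1 ≃ₗ[k] M) := by
    have hinj : Function.Injective (twistDual s (φ 0)) := by
      have h1 := cokernelMap_injective hδ 0
      have h2 : Function.Injective (coboundaries (twistComplex s φ) 0).mkQ := by
        rw [← LinearMap.ker_eq_bot, Submodule.ker_mkQ]; rfl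
      exact h1.comp h2
    obtain ⟨Δ, hΔ, hΔ'⟩ := ModExt.exists_connecting R (twistDual s (φ 0))
      (coboundaries (twistComplex s φ) 1).mkQ hinj (Submodule.mkQ_surjective _)
      (Submodule.ker_mkQ _).symm k
    exact nonempty_equiv_of_presentation s hs (φ 0) aug h.surj h.exact_zero
      (Δ.comp (homLinear k _).toLinearMap) (hΔ.comp (homLinear k _).surjective) hΔ'
  have hMne : ¬ Subsingleton M := fun hs => by
    have := Module.finrank_zero_of_subsingleton (R := k) (M := M)
    omega
  by_cases hne : ∃ i, e i ≠ 0
  swap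
  · push Not at hne
    have h1 (i q : ℕ) : 0 < q → Subsingleton (ModExt R (cohomology hδ i) R q) :=
      fun _ => hX0 i q (by simp [hne])
    have := h1 1 1 one_pos
    have := subsingleton_ext_cokernel_succ hδ hR 0 h1 1 (by omega) le_rfl 1
    have := he 0 (hne 0)
    obtain ⟨E⟩ := hW0
    exact absurd E.symm.toEquiv.subsingleton hMne
  classical
  let d := Nat.find hne
  have hd : e d ≠ 0 := Nat.find_spec hne
  have hd' (j : ℕ) (hj : j < d) : e j = 0 := not_not.1 (Nat.find_min hne hj)
  have hE (j : ℕ) (hj : j < d) : Subsingleton (cohomology hδ j) := he j (hd' j hj)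
  obtain ⟨t, ht, ht'⟩ : ∃ t, e t ≠ 0 ∧ ∀ q, t < q → e q = 0 := by
    have hfin : ∀ i, e i ≠ 0 → i ≤ n₀ := fun i hi => by
      by_contra hc
      exact hi (hn i (by omega))
    refine ⟨Nat.findGreatest (fun i => e i ≠ 0) n₀, Nat.findGreatest_spec (P := fun i => e i ≠ 0) (hfin d hd) hd, ?_⟩
    intro q hq
    by_contra hc
    exact absurd (Nat.le_findGreatest (P := fun i => e i ≠ 0) (hfin q hc) hc) (by omega)
  have hV (i q : ℕ) (hq : t < q) : Subsingleton (ModExt R (cohomology hδ i) R q) :=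
    hX0 i q (by rw [ht' q hq, mul_zero])
  have htd : t = d := by
    by_contra hc
    have hlt : d < t := by
      by_contra hc'
      exact ht (hd' t (by omega))
    have := subsingleton_ext_cokernel hδ d hE d t le_rfl hlt
    have := subsingleton_ext_coboundaries hδ hR t hV (t + 1) (by omega) (by omega) (d + 1)
    have := ModExt.subsingleton_left R _ _ (Submodule.injective_subtype _)
      (toCoboundaries_surjective hδ d) (cohomology_exact hδ d) t
    exact (mul_ne_zero hd ht) (hX1 d t)
  rw [htd] at hV ht'
  have hz (i : ℕ) (hi : i ≠ d) : e i = 0 := by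
    rcases lt_or_gt_of_ne hi with h | h
    · exact hd' i h
    · exact ht' i h
  have hfinal : Nonempty (ModExt R (cohomology hδ d) R d ≃ₗ[k] M) := by
    rcases Nat.eq_zero_or_pos d with h0 | h0
    · rw [h0] at hV ⊢
      have := hX0 1 1 (by rw [hz 1 (by omega), mul_zero])
      have := subsingleton_ext_cokernel_succ hδ hR 0 hV 1 (by omega) le_rfl 1
      have := subsingleton_ext_coboundaries hδ hR 0 hV 1 (by omega) le_rfl 1
      let r : cohomology hδ 0 →ₗ[R] (Fin (m 0) → R) :=
        (Submodule.quotEquivOfEqBot (coboundaries (twistComplex s φ) 0) rfl).toLinearMap.comp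
          (cohomology hδ 0).subtype
      have hr : LinearMap.range r = LinearMap.ker (twistDual s (φ 0)) := by
        ext x
        constructor
        · rintro ⟨⟨y, hy⟩, rfl⟩
          obtain ⟨y, rfl⟩ := Submodule.Quotient.mk_surjective _ y
          exact hy
        · intro hx
          exact ⟨⟨Submodule.Quotient.mk x, hx⟩, rfl⟩
      let Θ : ((Fin (m 0) → R) →ₗ[R] R) →ₗ[k] (cohomology hδ 0 →ₗ[R] R) :=
        { toFun := fun f => f.comp r
          map_add' := fun _ _ => rfl
          map_smul' := fun _ _ => rfl }
      obtain ⟨E⟩ := nonempty_equiv_of_presentation s hs (φ 0) aug h.surj h.exact_zero Θ (by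
        intro f
        obtain ⟨g, hg⟩ := ModExt.exists_extension R _ _ (Submodule.injective_subtype _)
          (toCoboundaries_surjective hδ 0) (cohomology_exact hδ 0) f
        refine ⟨g.comp (coboundaries (twistComplex s φ) 0).mkQ, ?_⟩
        rw [← hg]
        refine LinearMap.ext fun ⟨y, hy⟩ => ?_
        obtain ⟨y, rfl⟩ := Submodule.Quotient.mk_surjective _ y
        rfl) (by
        intro f
        constructor
        · intro hf
          refine extend_of_ext_cokernel_one (δ := twistComplex s φ) f ?_
          rw [← hr]
          exact LinearMap.range_le_ker_iff.2 hf
        · rintro ⟨g, rfl⟩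
          change (g.comp (twistDual s (φ 0))).comp r = 0
          rw [LinearMap.comp_assoc, LinearMap.range_le_ker_iff.1 hr.le, LinearMap.comp_zero])
      exact ⟨(homLinear k _).symm.trans E⟩
    · obtain ⟨j, hj⟩ : ∃ j, d = j + 1 := ⟨d - 1, by omega⟩
      have := hE 0 h0
      obtain ⟨E⟩ := hW0
      rw [hj] at hV hE ⊢
      obtain ⟨E'⟩ := nonempty_ext_cokernel_equiv hδ k (j + 1) hE j le_rfl
      have := subsingleton_ext_coboundaries hδ hR (j + 1) hV (j + 1) (by omega) (by omega) (j + 1 + 1)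
      have := subsingleton_ext_coboundaries hδ hR (j + 1) hV (j + 1 + 1) (by omega) (by omega)
        (j + 1 + 1)
      obtain ⟨E''⟩ := ModExt.nonempty_equiv_left R _ _ (Submodule.injective_subtype _)
        (toCoboundaries_surjective hδ (j + 1)) (cohomology_exact hδ (j + 1)) k (j + 1)
      exact ⟨E''.symm.trans (E'.symm.trans E)⟩
  obtain ⟨E⟩ := hfinal
  obtain ⟨E'⟩ := hX d d
  have h1 := (E'.symm.trans E).finrank_eq
  rw [hM, Module.finrank_fin_fun] at h1
  exact ⟨d, Nat.eq_one_of_mul_eq_one_right h1, hz⟩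

end Corner

section Sweedler

open Coalgebra HopfAlgebra

variable {k : Type u} [CommRing k] {H : Type u} [Ring H] [HopfAlgebra k H]
  {N : Type u} [AddCommGroup N] [Module k N]

theorem sum_counit_right_smul (a : H) :
    ∑ i ∈ (ℛ k a).index, counit (R := k) ((ℛ k a).right i) • (ℛ k a).left i = a := by
  have := congrArg (TensorProduct.rid k H) (sum_tmul_counit_eq (R := k) (ℛ k a))
  simpa only [map_sum, TensorProduct.rid_tmul, one_smul] using this

theorem sum_sum_mul_antipode (g : H →ₗ[k] H →ₗ[k] N) (h : H) :
    ∑ i ∈ (ℛ k h).index, ∑ j ∈ (ℛ k ((ℛ k h).left i)).index,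
      g ((ℛ k ((ℛ k h).left i)).left j)
        ((ℛ k ((ℛ k h).left i)).right j * antipode k ((ℛ k h).right i)) = g h 1 := by
  have h1 := congrArg (TensorProduct.lift g ∘ₗ
    LinearMap.lTensor H (LinearMap.mul' k H ∘ₗ LinearMap.lTensor H (antipode k)))
    (sum_tmul_tmul_eq (ℛ k h) (fun i => ℛ k ((ℛ k h).left i)) (fun i => ℛ k ((ℛ k h).right i)))
  simp only [map_sum, LinearMap.comp_apply, LinearMap.lTensor_tmul, TensorProduct.lift.tmul,
    LinearMap.mul'_apply] at h1
  rw [h1]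
  conv_rhs => rw [← sum_counit_right_smul (k := k) h, map_sum, LinearMap.sum_apply]
  refine Finset.sum_congr rfl fun i _ => ?_
  rw [← map_sum, sum_mul_antipode_eq_smul, map_smul, map_smul, LinearMap.smul_apply]

theorem sum_sum_antipode_mul (g : H →ₗ[k] H →ₗ[k] N) (h : H) :
    ∑ i ∈ (ℛ k h).index, ∑ j ∈ (ℛ k ((ℛ k h).left i)).index,
      g ((ℛ k ((ℛ k h).left i)).left j)
        (antipode k ((ℛ k ((ℛ k h).left i)).right j) * (ℛ k h).right i) = g h 1 := by
  have h1 := congrArg (TensorProduct.lift g ∘ₗ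
    LinearMap.lTensor H (LinearMap.mul' k H ∘ₗ LinearMap.rTensor H (antipode k)))
    (sum_tmul_tmul_eq (ℛ k h) (fun i => ℛ k ((ℛ k h).left i)) (fun i => ℛ k ((ℛ k h).right i)))
  simp only [map_sum, LinearMap.comp_apply, LinearMap.lTensor_tmul, LinearMap.rTensor_tmul,
    TensorProduct.lift.tmul, LinearMap.mul'_apply] at h1
  rw [h1]
  conv_rhs => rw [← sum_counit_right_smul (k := k) h, map_sum, LinearMap.sum_apply]
  refine Finset.sum_congr rfl fun i _ => ?_
  rw [← map_sum, sum_antipode_mul_eq_smul, map_smul, map_smul, LinearMap.smul_apply]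

/-- The right action of the dual algebra on a coalgebra: `a ↦ ∑ g a₂ • a₁`. -/
def hit (g : H →ₗ[k] k) : H →ₗ[k] H :=
  (TensorProduct.rid k H).toLinearMap ∘ₗ LinearMap.lTensor H g ∘ₗ comul

theorem hit_apply (g : H →ₗ[k] k) (a : H) :
    hit g a = ∑ i ∈ (ℛ k a).index, g ((ℛ k a).right i) • (ℛ k a).left i := by
  simp only [hit, LinearMap.comp_apply]
  conv_lhs => rw [← (ℛ k a).eq]
  simp

theorem sum_hit_hit {ι : Type*} (t : Finset ι) (g g' : ι → H →ₗ[k] k) (r : k)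
    (hg : ∀ a, ∑ x ∈ t, ∑ i ∈ (ℛ k a).index, g x ((ℛ k a).left i) * g' x ((ℛ k a).right i) =
      r * counit a) (a : H) : ∑ x ∈ t, hit (g x) (hit (g' x) a) = r • a := by
  have key (x : ι) : hit (g x) (hit (g' x) a) = ∑ i ∈ (ℛ k a).index,
      (∑ j ∈ (ℛ k ((ℛ k a).right i)).index,
        g x ((ℛ k ((ℛ k a).right i)).left j) * g' x ((ℛ k ((ℛ k a).right i)).right j)) •
        (ℛ k a).left i := by
    have h1 := congrArg ((TensorProduct.rid k H).toLinearMap ∘ₗ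
      LinearMap.lTensor H (LinearMap.mul' k k ∘ₗ TensorProduct.map (g x) (g' x)))
      (sum_tmul_tmul_eq (ℛ k a) (fun i => ℛ k ((ℛ k a).left i)) (fun i => ℛ k ((ℛ k a).right i)))
    simp only [map_sum, LinearMap.comp_apply, LinearMap.lTensor_tmul, TensorProduct.map_tmul,
      LinearMap.mul'_apply, LinearEquiv.coe_coe, TensorProduct.rid_tmul] at h1
    simp_rw [Finset.sum_smul]
    rw [← h1, hit_apply (g' x) a, map_sum]
    refine Finset.sum_congr rfl fun i _ => ?_
    rw [map_smul, hit_apply, Finset.smul_sum]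
    refine Finset.sum_congr rfl fun j _ => ?_
    rw [smul_smul, mul_comm]
  simp_rw [key]
  rw [Finset.sum_comm]
  simp_rw [← Finset.sum_smul, hg, mul_smul, ← Finset.smul_sum]
  congr 1
  exact sum_counit_right_smul a

end Sweedler

section Synonyms

/-- The tensor product `P ⊗[k] M`, to be equipped with its diagonal `H`-action. -/
def DTensor (k : Type u) [Field k] (_H : Type u) (P M : Type u) [AddCommGroup P] [Module k P]
    [AddCommGroup M] [Module k M] : Type u := P ⊗[k] M

/-- The space `M →ₗ[k] N`, to be equipped with the `H`-action
`(h • f) m = ∑ h₁ • f (S h₂ • m)`. -/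
def DHom (k : Type u) [Field k] (_H : Type u) (M N : Type u) [AddCommGroup M] [Module k M]
    [AddCommGroup N] [Module k N] : Type u := M →ₗ[k] N

variable (k : Type u) [Field k] (H : Type u) (P M N : Type u) [AddCommGroup P] [Module k P]
  [AddCommGroup M] [Module k M] [AddCommGroup N] [Module k N]

noncomputable instance : AddCommGroup (DTensor k H P M) :=
  inferInstanceAs (AddCommGroup (P ⊗[k] M))

noncomputable instance : Module k (DTensor k H P M) := inferInstanceAs (Module k (P ⊗[k] M))

noncomputable instance : AddCommGroup (DHom k H M N) := inferInstanceAs (AddCommGroup (M →ₗ[k] N))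

noncomputable instance : Module k (DHom k H M N) := inferInstanceAs (Module k (M →ₗ[k] N))

/-- The identification of `DTensor` with the tensor product. -/
noncomputable def DTensor.equiv : P ⊗[k] M ≃ₗ[k] DTensor k H P M := LinearEquiv.refl k (P ⊗[k] M)

/-- The identification of `DHom` with the space of linear maps. -/
noncomputable def DHom.equiv : DHom k H M N ≃ₗ[k] (M →ₗ[k] N) := LinearEquiv.refl k (M →ₗ[k] N)

variable {k H P M}

theorem DTensor.induction {p : DTensor k H P M → Prop} (h0 : p 0)
    (h1 : ∀ x y, p (DTensor.equiv k H P M (x ⊗ₜ y))) (h2 : ∀ x y, p x → p y → p (x + y))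
    (x : DTensor k H P M) : p x :=
  TensorProduct.induction_on (motive := fun z => p (DTensor.equiv k H P M z)) x h0 h1
    fun _ _ => h2 _ _

end Synonyms

section TensorHom

open Coalgebra HopfAlgebra

variable (k : Type u) [Field k] (H : Type u) [Ring H] [HopfAlgebra k H]
  (P M N : Type u) [AddCommGroup P] [Module k P] [Module H P] [IsScalarTower k H P]
  [AddCommGroup M] [Module k M] [Module H M] [IsScalarTower k H M]
  [AddCommGroup N] [Module k N] [Module H N] [IsScalarTower k H N]

noncomputable instance : Module H (DTensor k H P M) := tensorModule k H P M

theorem DTensor.smul_equiv (h : H) (x : P ⊗[k] M) :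
    h • DTensor.equiv k H P M x = DTensor.equiv k H P M (tensorRep k H P M h x) := rfl

instance : IsScalarTower k H (DTensor k H P M) where
  smul_assoc c h x := by
    obtain ⟨x, rfl⟩ := (DTensor.equiv k H P M).surjective x
    rw [DTensor.smul_equiv, DTensor.smul_equiv, map_smul, LinearMap.smul_apply, map_smul]

theorem DTensor.smul_tmul (h : H) (p : P) (m : M) :
    h • DTensor.equiv k H P M (p ⊗ₜ[k] m) = DTensor.equiv k H P M
      (∑ i ∈ (ℛ k h).index, ((ℛ k h).left i • p) ⊗ₜ[k] ((ℛ k h).right i • m)) := by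
  rw [DTensor.smul_equiv, tensorRep, AlgHom.comp_apply]
  congr 1
  change (((Module.endTensorEndAlgHom (R := k) (S := k) (A := k) (M := P) (N := M)).comp
    (Algebra.TensorProduct.map (hRep k H P) (hRep k H M))) (comul h)) (p ⊗ₜ[k] m) = _
  rw [← (ℛ k h).eq, map_sum, LinearMap.sum_apply]
  rfl

/-- Postcomposition with the action of `H`. -/
noncomputable def postRep : H →ₐ[k] Module.End k (M →ₗ[k] N) :=
  AlgHom.ofLinearMap
    (LinearMap.llcomp k M N N ∘ₗ (hRep k H N).toLinearMap) (by ext; simp [hRep])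
    (by intro a b; ext f m; simp [hRep])

/-- Precomposition with the action of `H` through the antipode. -/
noncomputable def preRep : H →ₐ[k] Module.End k (M →ₗ[k] N) :=
  AlgHom.ofLinearMap
    ((LinearMap.llcomp k M M N).flip ∘ₗ (hRep k H M).toLinearMap ∘ₗ antipode k)
    (by ext; simp [hRep])
    (by intro a b; ext f m; simp [hRep, antipode_mul_antidistrib])

theorem commute_postRep_preRep (a b : H) :
    Commute (postRep k H M N a) (preRep k H M N b) := by
  ext f m
  simp [postRep, preRep, hRep]

/-- The representation of `H` on `M →ₗ[k] N`. -/
noncomputable def homRep : H →ₐ[k] Module.End k (M →ₗ[k] N) :=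
  (Algebra.TensorProduct.lift (postRep k H M N) (preRep k H M N)
    (commute_postRep_preRep k H M N)).comp (Bialgebra.comulAlgHom k H)

noncomputable instance : Module H (DHom k H M N) :=
  Module.compHom (M →ₗ[k] N) ((homRep k H M N).toRingHom : H →+* Module.End k (M →ₗ[k] N))

theorem DHom.equiv_smul (h : H) (f : DHom k H M N) :
    DHom.equiv k H M N (h • f) = homRep k H M N h (DHom.equiv k H M N f) := rfl

instance : IsScalarTower k H (DHom k H M N) where
  smul_assoc c h x := by
    apply (DHom.equiv k H M N).injective
    rw [DHom.equiv_smul, map_smul, map_smul, DHom.equiv_smul, LinearMap.smul_apply]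

theorem DHom.smul_apply (h : H) (f : DHom k H M N) (m : M) : DHom.equiv k H M N (h • f) m =
    ∑ i ∈ (ℛ k h).index,
      (ℛ k h).left i • DHom.equiv k H M N f (antipode k ((ℛ k h).right i) • m) := by
  rw [DHom.equiv_smul, homRep, AlgHom.comp_apply]
  change (Algebra.TensorProduct.lift (postRep k H M N) (preRep k H M N)
    (commute_postRep_preRep k H M N)) (comul h)
    (DHom.equiv k H M N f) m = _
  rw [← (ℛ k h).eq, map_sum, LinearMap.sum_apply, LinearMap.sum_apply]
  rfl

variable {k H P M N}

/-- The adjunction between `DTensor` and `DHom`, from left to right. -/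
noncomputable def curryH (f : DTensor k H P M →ₗ[H] N) : P →ₗ[H] DHom k H M N where
  toFun p := (DHom.equiv k H M N).symm
    ((f.restrictScalars k ∘ₗ (DTensor.equiv k H P M).toLinearMap) ∘ₗ TensorProduct.mk k P M p)
  map_add' p q := by rw [← map_add, map_add (TensorProduct.mk k P M), LinearMap.comp_add]
  map_smul' h p := by
    apply (DHom.equiv k H M N).injective
    ext m
    rw [RingHom.id_apply, DHom.smul_apply]
    have h1 := sum_sum_mul_antipode (k := k) (H := H) (N := N)
      (LinearMap.mk₂ k (fun a b => f (DTensor.equiv k H P M ((a • p) ⊗ₜ (b • m))))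
        (by intros; rw [add_smul, TensorProduct.add_tmul, map_add, map_add])
        (by
          intros
          rw [smul_assoc, ← TensorProduct.smul_tmul', map_smul, LinearMap.map_smul_of_tower])
        (by intros; rw [add_smul, TensorProduct.tmul_add, map_add, map_add])
        (by intros; rw [smul_assoc, TensorProduct.tmul_smul, map_smul,
          LinearMap.map_smul_of_tower])) h
    simp only [LinearMap.mk₂_apply, one_smul] at h1
    simp only [LinearEquiv.apply_symm_apply, LinearMap.comp_apply, LinearEquiv.coe_coe,
      LinearMap.coe_restrictScalars, TensorProduct.mk_apply]
    rw [← h1]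
    refine Finset.sum_congr rfl fun i _ => ?_
    rw [← map_smul, DTensor.smul_tmul, map_sum, map_sum]
    simp_rw [mul_smul]

/-- The linear map underlying `uncurryH`. -/
noncomputable def uncurryLinear (F : P →ₗ[H] DHom k H M N) : DTensor k H P M →ₗ[k] N :=
  TensorProduct.lift ((DHom.equiv k H M N).toLinearMap ∘ₗ F.restrictScalars k) ∘ₗ
    (DTensor.equiv k H P M).symm.toLinearMap

theorem uncurryLinear_apply (F : P →ₗ[H] DHom k H M N) (p : P) (m : M) :
    uncurryLinear F (DTensor.equiv k H P M (p ⊗ₜ m)) = DHom.equiv k H M N (F p) m := rfl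

/-- The adjunction between `DTensor` and `DHom`, from right to left. -/
noncomputable def uncurryH (F : P →ₗ[H] DHom k H M N) : DTensor k H P M →ₗ[H] N where
  __ := uncurryLinear F
  map_smul' h x := by
    change uncurryLinear F (h • x) = h • uncurryLinear F x
    induction x using DTensor.induction with
    | h0 => rw [smul_zero, map_zero, smul_zero]
    | h2 x y hx hy => rw [map_add, smul_add, smul_add, ← hx, ← hy, map_add]
    | h1 p m =>
      rw [DTensor.smul_tmul, map_sum, map_sum]
      have h1 := sum_sum_antipode_mul (k := k) (H := H) (N := N)
        (LinearMap.mk₂ k (fun a b => a • DHom.equiv k H M N (F p) (b • m))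
          (by intros; rw [add_smul])
          (by intros; rw [smul_assoc])
          (by intros; rw [add_smul, map_add, smul_add])
          (by intros; rw [smul_assoc, map_smul, smul_comm])) h
      simp only [LinearMap.mk₂_apply, one_smul] at h1
      rw [uncurryLinear_apply, ← h1]
      refine Finset.sum_congr rfl fun i _ => ?_
      rw [uncurryLinear_apply, map_smul F, DHom.smul_apply]
      simp_rw [mul_smul]

/-- The adjunction between `DTensor` and `DHom`. -/
noncomputable def curryEquiv : (DTensor k H P M →ₗ[H] N) ≃ₗ[k] (P →ₗ[H] DHom k H M N) where
  toFun := curryH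
  invFun := uncurryH
  map_add' _ _ := rfl
  map_smul' _ _ := rfl
  left_inv f := by
    ext x
    induction x using DTensor.induction with
    | h0 => simp only [map_zero]
    | h2 x y hx hy => rw [map_add, map_add, hx, hy]
    | h1 p m => rfl
  right_inv F := rfl

theorem curryEquiv_apply (f : DTensor k H P M →ₗ[H] N) (p : P) (m : M) :
    DHom.equiv k H M N (curryEquiv f p) m = f (DTensor.equiv k H P M (p ⊗ₜ m)) := rfl

end TensorHom

section TensorComplexes

open Coalgebra HopfAlgebra

variable {k : Type u} [Field k] {H : Type u} [Ring H] [HopfAlgebra k H]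
  {P Q M N : Type u} [AddCommGroup P] [Module k P] [Module H P] [IsScalarTower k H P]
  [AddCommGroup Q] [Module k Q] [Module H Q] [IsScalarTower k H Q]
  [AddCommGroup M] [Module k M] [Module H M] [IsScalarTower k H M]
  [AddCommGroup N] [Module k N] [Module H N] [IsScalarTower k H N]

/-- Functoriality of `DHom` in the second argument. -/
noncomputable def DHom.map (g : N →ₗ[H] Q) : DHom k H M N →ₗ[H] DHom k H M Q where
  toFun f := (DHom.equiv k H M Q).symm (g.restrictScalars k ∘ₗ DHom.equiv k H M N f)
  map_add' f f' := by rw [map_add, LinearMap.comp_add, map_add]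
  map_smul' h f := by
    apply (DHom.equiv k H M Q).injective
    ext m
    rw [RingHom.id_apply, DHom.smul_apply]
    simp only [LinearEquiv.apply_symm_apply, LinearMap.comp_apply, LinearMap.coe_restrictScalars]
    rw [DHom.smul_apply, map_sum]
    simp_rw [map_smul]

theorem DHom.map_surjective (g : N →ₗ[H] Q) (hg : Function.Surjective g) :
    Function.Surjective (DHom.map (k := k) (M := M) g) := by
  intro f
  obtain ⟨f', hf'⟩ := Module.projective_lifting_property (g.restrictScalars k)
    (DHom.equiv k H M Q f) hg
  exact ⟨(DHom.equiv k H M N).symm f', (DHom.equiv k H M Q).injective hf'⟩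

instance DTensor.projective [Module.Projective H P] : Module.Projective H (DTensor k H P M) := by
  refine Module.Projective.of_lifting_property'' fun f hf => ?_
  obtain ⟨F, hF⟩ := Module.projective_lifting_property (DHom.map (k := k) (M := M) f)
    (curryH (LinearMap.id : DTensor k H P M →ₗ[H] DTensor k H P M)) (DHom.map_surjective f hf)
  refine ⟨uncurryH F, LinearMap.ext fun x => ?_⟩
  induction x using DTensor.induction with
  | h0 => rw [map_zero, map_zero]
  | h2 x y hx hy => rw [map_add, map_add, hx, hy]
  | h1 p m => exact LinearMap.congr_fun (congrArg (DHom.equiv k H M _) (LinearMap.congr_fun hF p)) m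

/-- Functoriality of `DTensor` in the first argument. -/
noncomputable def DTensor.map (M : Type u) [AddCommGroup M] [Module k M] [Module H M]
    [IsScalarTower k H M] (φ : P →ₗ[H] Q) : DTensor k H P M →ₗ[H] DTensor k H Q M where
  toFun x := DTensor.equiv k H Q M
    ((φ.restrictScalars k).rTensor M ((DTensor.equiv k H P M).symm x))
  map_add' x y := by simp only [map_add]
  map_smul' h x := by
    induction x using DTensor.induction with
    | h0 => simp only [map_zero, smul_zero]
    | h2 x y hx hy => rw [smul_add, map_add, map_add, map_add, hx, hy]; simp only [map_add, smul_add]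
    | h1 p m =>
      rw [DTensor.smul_tmul, LinearEquiv.symm_apply_apply, LinearEquiv.symm_apply_apply, map_sum,
        LinearMap.rTensor_tmul, RingHom.id_apply, DTensor.smul_tmul]
      simp_rw [LinearMap.rTensor_tmul, LinearMap.coe_restrictScalars, map_smul]

theorem DTensor.map_tmul (φ : P →ₗ[H] Q) (p : P) (m : M) :
    DTensor.map M φ (DTensor.equiv k H P M (p ⊗ₜ m)) = DTensor.equiv k H Q M (φ p ⊗ₜ m) := rfl

theorem DTensor.map_surjective (φ : P →ₗ[H] Q) (hφ : Function.Surjective φ) :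
    Function.Surjective (DTensor.map (k := k) M φ) :=
  LinearMap.rTensor_surjective M (g := φ.restrictScalars k) hφ

theorem DTensor.range_map_eq_ker (φ : P →ₗ[H] Q) (ψ : Q →ₗ[H] N)
    (h : LinearMap.range φ = LinearMap.ker ψ) :
    LinearMap.range (DTensor.map (k := k) M φ) = LinearMap.ker (DTensor.map (k := k) M ψ) := by
  have h1 : Function.Exact (φ.restrictScalars k) (ψ.restrictScalars k) :=
    LinearMap.exact_iff.2 (congrArg (Submodule.restrictScalars k) h.symm)
  have h2 := Module.Flat.rTensor_exact M h1
  ext x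
  exact (h2 x).symm

end TensorComplexes

section Trivial

open Coalgebra

variable (k : Type u) [Field k] (H : Type u) [Ring H] [HopfAlgebra k H]

noncomputable instance : Module k (trivMod k H) := inferInstanceAs (Module k k)

theorem trivMod_smul (h : H) (x : trivMod k H) :
    h • x = Coalgebra.counit (R := k) h • x := rfl

instance : IsScalarTower k H (trivMod k H) where
  smul_assoc c h x := by rw [trivMod_smul, trivMod_smul, map_smul, smul_assoc]

variable (M : Type u) [AddCommGroup M] [Module k M]

/-- The identification of the trivial module with the ground field. -/
noncomputable def trivEquiv : trivMod k H ≃ₗ[k] k := LinearEquiv.refl k k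

/-- The linear equivalence underlying `trivTensor`. -/
noncomputable def trivTensorLinear : DTensor k H (trivMod k H) M ≃ₗ[k] M :=
  (DTensor.equiv k H (trivMod k H) M).symm.trans
    ((TensorProduct.congr (trivEquiv k H) (LinearEquiv.refl k M)).trans (TensorProduct.lid k M))

theorem trivTensorLinear_tmul (p : trivMod k H) (m : M) :
    trivTensorLinear k H M (DTensor.equiv k H _ M (p ⊗ₜ m)) = trivEquiv k H p • m := rfl

variable [Module H M] [IsScalarTower k H M]

/-- The trivial module is a unit for the diagonal tensor product. -/
noncomputable def trivTensor : DTensor k H (trivMod k H) M ≃ₗ[H] M where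
  __ := trivTensorLinear k H M
  map_smul' h x := by
    change trivTensorLinear k H M (h • x) = h • trivTensorLinear k H M x
    induction x using DTensor.induction with
    | h0 => simp only [map_zero, smul_zero]
    | h2 x y hx hy => rw [smul_add, map_add, map_add, hx, hy, smul_add]
    | h1 p m =>
      rw [DTensor.smul_tmul, map_sum, map_sum, trivTensorLinear_tmul, smul_comm]
      conv_rhs => rw [← Coalgebra.sum_counit_smul (R := k) (ℛ k h), Finset.sum_smul,
        Finset.smul_sum]
      refine Finset.sum_congr rfl fun i _ => ?_
      rw [trivTensorLinear_tmul, trivMod_smul, map_smul, smul_assoc, smul_assoc, smul_comm]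

end Trivial

section Straightening

open Coalgebra HopfAlgebra

variable {k : Type u} [Field k] {H : Type u} [Ring H] [HopfAlgebra k H]
  {M : Type u} [AddCommGroup M] [Module k M] [Module H M] [IsScalarTower k H M]
  {r : ℕ} (b : Module.Basis (Fin r) k M)

/-- The matrix coefficients of a module twisted by a linear endomorphism of `H`. -/
noncomputable def matCoeff (s : H →ₗ[k] H) (i j : Fin r) : H →ₗ[k] k :=
  b.coord i ∘ₗ (hRep k H M).toLinearMap.flip (b j) ∘ₗ s

theorem matCoeff_apply (s : H →ₗ[k] H) (i j : Fin r) (a : H) :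
    matCoeff b s i j a = b.coord i (s a • b j) := rfl

theorem sum_matCoeff_mul (x y : H) (s t : H →ₗ[k] H) (i l : Fin r) :
    ∑ j, matCoeff b s i j x * matCoeff b t j l y = b.coord i ((s x * t y) • b l) := by
  conv_rhs => rw [mul_smul, ← b.sum_repr (t y • b l), Finset.smul_sum, map_sum]
  refine Finset.sum_congr rfl fun j _ => ?_
  rw [matCoeff_apply, matCoeff_apply, smul_comm, LinearMap.map_smul (b.coord i), smul_eq_mul,
    mul_comm]
  rfl

theorem coord_counit_smul (x : k) (i l : Fin r) :
    b.coord i ((x • (1 : H)) • b l) = (if i = l then 1 else 0) * x := by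
  rw [smul_assoc, one_smul, map_smul, Module.Basis.coord_apply, b.repr_self,
    Finsupp.single_apply, smul_eq_mul, mul_comm]
  simp only [eq_comm]

theorem sum_matCoeff_sq (i l : Fin r) (a : H) :
    ∑ j, ∑ x ∈ (ℛ k a).index, matCoeff b (antipode k ∘ₗ antipode k) j l ((ℛ k a).left x) *
      matCoeff b (antipode k) i j ((ℛ k a).right x) = (if i = l then 1 else 0) * counit a := by
  rw [Finset.sum_comm, ← coord_counit_smul (H := H) b]
  simp_rw [mul_comm (matCoeff b (antipode k ∘ₗ antipode k) _ _ _), sum_matCoeff_mul,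
    LinearMap.comp_apply, ← antipode_mul_antidistrib]
  rw [← map_sum, ← Finset.sum_smul, ← map_sum, sum_antipode_mul_eq_smul,
    LinearMap.map_smul (antipode k), antipode_one]

theorem sum_matCoeff_sq' (i l : Fin r) (a : H) :
    ∑ j, ∑ x ∈ (ℛ k a).index, matCoeff b (antipode k) j l ((ℛ k a).left x) *
      matCoeff b (antipode k ∘ₗ antipode k) i j ((ℛ k a).right x) =
        (if i = l then 1 else 0) * counit a := by
  rw [Finset.sum_comm, ← coord_counit_smul (H := H) b]
  simp_rw [mul_comm (matCoeff b (antipode k) _ _ _), sum_matCoeff_mul,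
    LinearMap.comp_apply, ← antipode_mul_antidistrib]
  rw [← map_sum, ← Finset.sum_smul, ← map_sum, sum_mul_antipode_eq_smul,
    LinearMap.map_smul (antipode k), antipode_one]

/-- The action of a matrix of linear functionals on vectors over `H`. -/
noncomputable def hitMatrix (c : Fin r → Fin r → H →ₗ[k] k) : (Fin r → H) →ₗ[k] (Fin r → H) :=
  LinearMap.pi fun j => ∑ i, hit (c i j) ∘ₗ LinearMap.proj i

theorem hitMatrix_apply (c : Fin r → Fin r → H →ₗ[k] k) (a : Fin r → H) (j : Fin r) :
    hitMatrix c a j = ∑ i, hit (c i j) (a i) := by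
  simp [hitMatrix]

theorem hitMatrix_hitMatrix (c c' : Fin r → Fin r → H →ₗ[k] k)
    (h : ∀ i l a, ∑ j, ∑ x ∈ (ℛ k a).index, c' j l ((ℛ k a).left x) * c i j ((ℛ k a).right x) =
      (if i = l then 1 else 0) * counit a) (a : Fin r → H) :
    hitMatrix c' (hitMatrix c a) = a := by
  ext l
  simp_rw [hitMatrix_apply, map_sum]
  rw [Finset.sum_comm]
  simp_rw [sum_hit_hit Finset.univ (fun j => c' j l) (fun j => c _ j) _ (h _ l)]
  simp

/-- The `H`-linear map from a free module to `DHom` given by a basis. -/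
noncomputable def straighten : (Fin r → H) →ₗ[H] DHom k H M H :=
  Fintype.linearCombination H
    (fun i => (DHom.equiv k H M H).symm ((b.coord i).smulRight (1 : H)))

theorem straighten_apply (a : Fin r → H) (j : Fin r) :
    DHom.equiv k H M H (straighten b a) (b j) = hitMatrix (matCoeff b (antipode k)) a j := by
  rw [straighten, Fintype.linearCombination_apply, map_sum, LinearMap.sum_apply, hitMatrix_apply]
  refine Finset.sum_congr rfl fun i _ => ?_
  rw [DHom.smul_apply, hit_apply]
  refine Finset.sum_congr rfl fun x _ => ?_
  rw [LinearEquiv.apply_symm_apply, LinearMap.smulRight_apply, smul_comm, smul_eq_mul, mul_one]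
  rfl

theorem straighten_bijective : Function.Bijective (straighten (H := H) b) := by
  let E : DHom k H M H ≃ₗ[k] (Fin r → H) := (DHom.equiv k H M H).trans (b.constr k).symm
  have h1 : Function.Bijective (hitMatrix (matCoeff (H := H) b (antipode k))) :=
    Function.bijective_iff_has_inverse.2 ⟨hitMatrix (matCoeff b (antipode k ∘ₗ antipode k)),
      hitMatrix_hitMatrix _ _ (sum_matCoeff_sq b), hitMatrix_hitMatrix _ _ (sum_matCoeff_sq' b)⟩
  have h2 : E ∘ straighten b = hitMatrix (matCoeff (H := H) b (antipode k)) := by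
    ext a j
    rw [← straighten_apply]
    simp [E, Module.Basis.constr]
  rw [← h2] at h1
  exact (Function.Bijective.of_comp_iff' E.bijective _).1 h1

variable {P Q : Type u} [AddCommGroup P] [Module k P] [Module H P] [IsScalarTower k H P]
  [AddCommGroup Q] [Module k Q] [Module H Q] [IsScalarTower k H Q]

/-- The dual of `DTensor k H P M` is a power of the dual of `P`. -/
noncomputable def dualTensorEquiv : (Fin r → (P →ₗ[H] H)) ≃ₗ[k] (DTensor k H P M →ₗ[H] H) :=
  LinearEquiv.trans
    (LinearEquiv.ofBijective
      { toFun := fun g => straighten b ∘ₗ LinearMap.pi g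
        map_add' := fun g g' => by
          rw [← LinearMap.comp_add]
          rfl
        map_smul' := fun c g => by
          ext p : 1
          exact LinearMap.map_smul_of_tower (straighten b) c (LinearMap.pi g p) }
      ⟨fun g g' h => by
          ext i p
          exact congrFun ((straighten_bijective b).1 (LinearMap.congr_fun h p)) i,
        fun f => by
          refine ⟨fun i => LinearMap.proj i ∘ₗ
            (LinearEquiv.ofBijective _ (straighten_bijective b)).symm.toLinearMap ∘ₗ f, ?_⟩
          ext p : 1
          exact (LinearEquiv.ofBijective _ (straighten_bijective b)).apply_symm_apply (f p)⟩)
    curryEquiv.symm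

theorem dualTensorEquiv_comp_map (φ : P →ₗ[H] Q) (g : Fin r → (Q →ₗ[H] H)) :
    (dualTensorEquiv b g).comp (DTensor.map M φ) = dualTensorEquiv b fun i => (g i).comp φ := by
  apply curryEquiv.injective
  ext p : 1
  apply (DHom.equiv k H M H).injective
  ext m
  rw [curryEquiv_apply, LinearMap.comp_apply, DTensor.map_tmul, ← curryEquiv_apply]
  simp only [dualTensorEquiv, LinearEquiv.trans_apply, LinearEquiv.apply_symm_apply]
  rfl

end Straightening

section SubQuot

theorem nonempty_subQuot_equiv_pi {k : Type u} [Field k] {V W : Type u} [AddCommGroup V] [Module k V]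
    [AddCommGroup W] [Module k W] {r : ℕ} (E : (Fin r → V) ≃ₗ[k] W) (A B : Submodule k V)
    (A' B' : Submodule k W) (hA : ∀ g, E g ∈ A' ↔ ∀ i, g i ∈ A)
    (hB : ∀ g, E g ∈ B' ↔ ∀ i, g i ∈ B) :
    Nonempty (subQuot A' (B'.comap A'.subtype) ≃ₗ[k]
      (Fin r → subQuot A (B.comap A.subtype))) := by
  let F : (Fin r → A) →ₗ[k] A' :=
    (E.toLinearMap ∘ₗ LinearMap.pi fun i => A.subtype ∘ₗ LinearMap.proj i).codRestrict _
      fun x => (hA _).2 fun i => (x i).2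
  have hF (x) : (F x : W) = E fun i => (x i : V) := rfl
  have hF' : Function.Bijective F := by
    refine ⟨fun x y h => ?_, fun y => ?_⟩
    · ext i
      exact congrFun (E.injective (congrArg Subtype.val h)) i
    · have hy := (hA (E.symm y)).1 (by rw [E.apply_symm_apply]; exact y.2)
      exact ⟨fun i => ⟨E.symm y i, hy i⟩, Subtype.ext (E.apply_symm_apply y)⟩
  refine ⟨((Submodule.Quotient.equiv _ _ (LinearEquiv.ofBijective F hF') ?_).symm).trans
    (Submodule.quotientPi fun _ : Fin r => B.comap A.subtype)⟩
  ext y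
  obtain ⟨x, rfl⟩ := (LinearEquiv.ofBijective F hF').surjective y
  rw [Submodule.mem_map_equiv, LinearEquiv.symm_apply_apply, Submodule.mem_comap]
  simp only [Submodule.mem_pi, Set.mem_univ, true_imp_iff, Submodule.mem_comap]
  exact (hB _).symm

end SubQuot

section TensorAugmentation

variable {k : Type u} [Field k] {H : Type u} [Ring H] [HopfAlgebra k H]
  (M : Type u) [AddCommGroup M] [Module k M] [Module H M] [IsScalarTower k H M]
  {P Q : Type u} [AddCommGroup P] [Module k P] [Module H P] [IsScalarTower k H P]
  [AddCommGroup Q] [Module k Q] [Module H Q] [IsScalarTower k H Q]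

/-- The augmentation of a tensor product with `M` induced by a map to the trivial module. -/
noncomputable def DTensor.aug (f : P →ₗ[H] trivMod k H) : DTensor k H P M →ₗ[H] M :=
  (trivTensor k H M).toLinearMap ∘ₗ DTensor.map M f

theorem DTensor.aug_surjective (f : P →ₗ[H] trivMod k H) (hf : Function.Surjective f) :
    Function.Surjective (DTensor.aug M f) :=
  (trivTensor k H M).surjective.comp (DTensor.map_surjective f hf)

theorem DTensor.ker_aug (f : P →ₗ[H] trivMod k H) (φ : Q →ₗ[H] P)
    (h : LinearMap.ker f = LinearMap.range φ) :
    LinearMap.ker (DTensor.aug M f) = LinearMap.range (DTensor.map (k := k) M φ) := by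
  rw [DTensor.range_map_eq_ker φ f h.symm]
  exact LinearEquiv.ker_comp _ _

end TensorAugmentation

section TensorResolution

attribute [local instance] ModuleCat.moduleOfAlgebraModule ModuleCat.isScalarTower_of_algebra_moduleCat

variable {k : Type u} [Field k] {H : Type u} [Ring H] [HopfAlgebra k H]
  (M : Type u) [AddCommGroup M] [Module k M] [Module H M] [IsScalarTower k H M]

variable (k) in
/-- The diagonal tensor product with `M`, as an object of `ModuleCat H`. -/
noncomputable def tensObj (P : ModuleCat.{u} H) : ModuleCat.{u} H := ModuleCat.of H (DTensor k H P M)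

variable (k) in
/-- The diagonal tensor product with `M`, on maps. -/
noncomputable def tensMap {P Q : ModuleCat.{u} H} (φ : P →ₗ[H] Q) :
    tensObj k M P →ₗ[H] tensObj k M Q := DTensor.map M φ

theorem tensObj_projective {P : ModuleCat.{u} H} (h : Module.Projective H P) :
    Module.Projective H (tensObj k M P) :=
  inferInstanceAs (Module.Projective H (DTensor k H P M))

theorem range_tensMap_eq_ker {P Q N : ModuleCat.{u} H} (φ : P →ₗ[H] Q) (ψ : Q →ₗ[H] N)
    (h : LinearMap.range φ = LinearMap.ker ψ) :
    LinearMap.range (tensMap k M φ) = LinearMap.ker (tensMap k M ψ) :=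
  DTensor.range_map_eq_ker φ ψ h

variable {P : ℕ → ModuleCat.{u} H} {dif : ∀ n, P (n + 1) →ₗ[H] P n}

theorem IsProjRes.tensor {aug : P 0 →ₗ[H] trivMod k H} (h : IsProjRes P dif aug) :
    IsProjRes (fun n => tensObj k M (P n)) (fun n => tensMap k M (dif n)) (DTensor.aug M aug) where
  proj n := tensObj_projective M (h.proj n)
  surj := DTensor.aug_surjective M aug h.surj
  exact_zero := DTensor.ker_aug M aug (dif 0) h.exact_zero
  exact_succ n := (range_tensMap_eq_ker M _ _ (h.exact_succ n).symm).symm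

variable {M}

theorem nonempty_extGrp_tensor {r : ℕ} (b : Module.Basis (Fin r) k M) (n : ℕ) :
    Nonempty (extGrp k H (fun n => tensObj k M (P n)) (fun n => tensMap k M (dif n)) n ≃ₗ[k]
      (Fin r → extGrp k H P dif n)) := by
  refine nonempty_subQuot_equiv_pi (dualTensorEquiv b) _ _ _ _ (fun g => ?_) fun g => ?_
  · rw [mem_ker_extδ]
    refine (Eq.congr (dualTensorEquiv_comp_map b (dif n) g) (map_zero (dualTensorEquiv b)).symm).trans ?_
    rw [(dualTensorEquiv b).injective.eq_iff, funext_iff]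
    rfl
  · cases n with
    | zero =>
      refine (dualTensorEquiv b).map_eq_zero_iff.trans ?_
      rw [funext_iff]
      rfl
    | succ n =>
      constructor
      · rintro ⟨f, hf⟩ i
        obtain ⟨g', rfl⟩ := (dualTensorEquiv b).surjective f
        refine ⟨g' i, ?_⟩
        exact congrFun ((dualTensorEquiv b).injective
          ((dualTensorEquiv_comp_map b (dif n) g').symm.trans hf)) i
      · intro h
        choose g' hg' using h
        refine ⟨dualTensorEquiv b g', ?_⟩
        exact (dualTensorEquiv_comp_map b (dif n) g').trans (congrArg _ (funext hg'))

theorem nonempty_ext_equiv_fin {aug : P 0 →ₗ[H] trivMod k H} (h : IsProjRes P dif aug)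
    [Module.Finite k M] (n : ℕ) [Module.Finite k (extGrp k H P dif n)] :
    Nonempty (ModExt H M H n ≃ₗ[k]
      (Fin (Module.finrank k M * Module.finrank k (extGrp k H P dif n)) → k)) := by
  obtain ⟨e₁⟩ := (h.tensor M).nonempty_extGrp k n
  obtain ⟨e₂⟩ := nonempty_extGrp_tensor (dif := dif) (Module.finBasis k M) n
  have : Module.Finite k (ModExt H M H n) := Module.Finite.equiv (e₂.symm.trans e₁)
  refine ⟨LinearEquiv.ofFinrankEq _ _ ?_⟩
  rw [← (e₂.symm.trans e₁).finrank_eq, Module.finrank_fin_fun, Module.finrank_pi_fintype]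
  simp

variable [IsNoetherianRing H] {X : ℤ → ModuleCat.{u} H} {d : ∀ i : ℤ, X (i + 1) →ₗ[H] X i}

variable (k M)

theorem isGorensteinProjective_ker_tensMap (hp : ∀ i, Module.Projective H (X i))
    (ha : ∀ i, LinearMap.range (d (i + 1)) = LinearMap.ker (d i)) {n : ℕ}
    (hH : InjDimLT H H (n + 1)) :
    IsGorensteinProjective H (LinearMap.ker (tensMap k M (d 0))) :=
  ⟨fun i => tensObj k M (X i), fun i => tensMap k M (d i), fun i => tensObj_projective M (hp i),
    fun i => range_tensMap_eq_ker M _ _ (ha i),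
    fun _ hQ i f hf => hom_exact_of_injDimLT (d := fun i => tensMap k M (d i))
      (fun i => tensObj_projective M (hp i))
      (fun i => range_tensMap_eq_ker M _ _ (ha i)) (hH.projective n hQ) i f hf,
    ⟨LinearEquiv.refl _ _⟩⟩

end TensorResolution

section Cohomology

variable {k R : Type u} [Field k] [Ring R] [Algebra k R]

theorem nonempty_extGrp_equiv_cohomology (s : R ≃ₗ[k] R) (hs : ∀ a b, s (a * b) = s b * s a)
    {m : ℕ → ℕ} (φ : ∀ n, (Fin (m (n + 1)) → R) →ₗ[R] (Fin (m n) → R))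
    (hδ : ∀ n, (twistComplex s φ (n + 1)).comp (twistComplex s φ n) = 0) (j : ℕ) :
    Nonempty (extGrp k R (fun n => ModuleCat.of R (Fin (m n) → R)) φ j ≃ₗ[k] cohomology hδ j) := by
  let F : LinearMap.ker (extδ k R (fun n => ModuleCat.of R (Fin (m n) → R)) φ j) →ₗ[k]
      cohomology hδ j :=
    LinearMap.codRestrict ((cohomology hδ j).restrictScalars k)
      ((coboundaries (twistComplex s φ) j).mkQ.restrictScalars k ∘ₗ
        (dualEquiv s (m j)).toLinearMap ∘ₗ Submodule.subtype _)
      (fun x => by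
        change twistDual s (φ j) (dualEquiv s (m j) x) = 0
        rw [← dualEquiv_comp s hs]
        exact (congrArg _ x.2).trans (map_zero _))
  have hF : Function.Surjective F := by
    rintro ⟨y, hy⟩
    obtain ⟨y, rfl⟩ := Submodule.mkQ_surjective _ y
    obtain ⟨f, rfl⟩ := (dualEquiv s (m j)).surjective y
    refine ⟨⟨f, ?_⟩, rfl⟩
    rw [mem_ker_extδ]
    apply (dualEquiv s _).injective
    refine (dualEquiv_comp s hs (φ j) f).trans ?_
    rw [map_zero]
    exact hy
  refine ⟨(Submodule.quotEquivOfEq _ _ ?_).trans (F.quotKerEquivOfSurjective hF)⟩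
  ext ⟨f, hf⟩
  rw [LinearMap.mem_ker, Subtype.ext_iff]
  refine Iff.trans ?_ (Submodule.Quotient.mk_eq_zero _).symm
  change f ∈ extBoundary k R (fun n => ModuleCat.of R (Fin (m n) → R)) φ j ↔
    dualEquiv s (m j) f ∈ _
  cases j with
  | zero => exact (dualEquiv s (m 0)).map_eq_zero_iff.symm
  | succ j =>
    constructor
    · rintro ⟨g, rfl⟩
      exact ⟨dualEquiv s (m j) g, (dualEquiv_comp s hs (φ j) g).symm⟩
    · rintro ⟨v, hv⟩
      obtain ⟨g, rfl⟩ := (dualEquiv s (m j)).surjective v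
      exact ⟨g, (dualEquiv s _).injective ((dualEquiv_comp s hs (φ j) g).trans hv)⟩

end Cohomology

section Assembly

open HopfAlgebra

variable {k : Type u} [Field k] {H : Type u} [Ring H] [HopfAlgebra k H]

instance : Module.Finite k (trivMod k H) := Module.Finite.equiv (trivEquiv k H).symm

instance : Module.Finite H (trivMod k H) := Module.Finite.of_restrictScalars_finite k H _

theorem finrank_trivMod : Module.finrank k (trivMod k H) = 1 := by
  rw [(trivEquiv k H).finrank_eq, Module.finrank_self]

theorem twistComplex_comp {R : Type u} [Ring R] [Algebra k R] (s : R ≃ₗ[k] R)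
    (hs : ∀ a b, s (a * b) = s b * s a) {m : ℕ → ℕ}
    (φ : ∀ n, (Fin (m (n + 1)) → R) →ₗ[R] (Fin (m n) → R))
    (h : ∀ n, (φ n).comp (φ (n + 1)) = 0) (n : ℕ) :
    (twistComplex s φ (n + 1)).comp (twistComplex s φ n) = 0 := by
  refine LinearMap.ext fun v => ?_
  obtain ⟨f, rfl⟩ := (dualEquiv s (m n)).surjective v
  rw [LinearMap.comp_apply, ← dualEquiv_comp s hs, ← dualEquiv_comp s hs, LinearMap.comp_assoc, h,
    LinearMap.comp_zero, map_zero, LinearMap.zero_apply]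

theorem injDimLT_of_injDim_eq {R : Type u} [Ring R] {M : Type u} [AddCommGroup M] [Module R M]
    {n : ℕ} (h : injDim R M = n) : InjDimLT R M (n + 1) := by
  have hne : {n : ℕ∞ | ∃ m : ℕ, n = (m : ℕ∞) ∧ InjDimLE R m M}.Nonempty := by
    by_contra! h'
    rw [injDim, h', sInf_empty] at h
    exact ENat.top_ne_natCast n h
  obtain ⟨m, hm, hm'⟩ := csInf_mem hne
  rw [← injDim, h] at hm
  rw [← injDimLE_iff, Nat.cast_inj.1 hm]
  exact hm'

theorem injDim_eq {R : Type u} [Ring R] {M : Type u} [AddCommGroup M] [Module R M]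
    {n : ℕ} (h : InjDimLT R M (n + 1)) (N : Type u) [AddCommGroup N] [Module R N]
    (hN : ¬ Subsingleton (ModExt R N M n)) : injDim R M = n := by
  refine le_antisymm (sInf_le ⟨n, rfl, (injDimLE_iff n).2 h⟩) (le_sInf ?_)
  rintro _ ⟨m, rfl, hm⟩
  by_contra! hlt
  exact hN (((injDimLE_iff m).1 hm).subsingleton N n (by exact_mod_cast hlt))

section Glue

variable (M : Type u) [AddCommGroup M] [Module k M] [Module H M] [IsScalarTower k H M]
  {P : ℕ → ModuleCat.{u} H} {dif : ∀ n, P (n + 1) →ₗ[H] P n} {d : ℕ} {B : ℕ → ModuleCat.{u} H}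
  {γ : P d →ₗ[H] B 0} {β : ∀ n, B n →ₗ[H] B (n + 1)} {n : ℕ}

variable (H) in
/-- Maps between modules, bundled with their domain and codomain. -/
abbrev ModMap : Type (u + 1) := Σ A B : ModuleCat.{u} H, A →ₗ[H] B

theorem isGorensteinProjective_ker_tensMap_glue [IsNoetherianRing H]
    (hP : ∀ n, Module.Projective H (P n))
    (hB : ∀ n, Module.Projective H (B n))
    (hX : ∀ i, LinearMap.range
        (glueMap (fun n => P (d + n)) B (fun n => dif (d + n)) γ β (i + 1)) =
      LinearMap.ker (glueMap (fun n => P (d + n)) B (fun n => dif (d + n)) γ β i))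
    (hH : InjDimLT H H (n + 1)) :
    IsGorensteinProjective H (LinearMap.ker (tensMap k M (dif d))) := by
  have h1 : (⟨_, _, glueMap (fun n => P (d + n)) B (fun n => dif (d + n)) γ β 0⟩ : ModMap H) =
    ⟨P (d + 1), P d, dif d⟩ := rfl
  have h2 := isGorensteinProjective_ker_tensMap k M
    (glue_projective (fun n => hP (d + n)) hB) hX hH
  have h3 (x y : ModMap H) (hxy : x = y)
      (hx : IsGorensteinProjective H (LinearMap.ker (tensMap k M x.2.2))) :
      IsGorensteinProjective H (LinearMap.ker (tensMap k M y.2.2)) := hxy ▸ hx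
  exact h3 _ _ h1 h2

theorem subsingleton_extGrp_tensMap_glue
    (hP : ∀ n, Module.Projective H (P n))
    (hB : ∀ n, Module.Projective H (B n))
    (hX : ∀ i, LinearMap.range
        (glueMap (fun n => P (d + n)) B (fun n => dif (d + n)) γ β (i + 1)) =
      LinearMap.ker (glueMap (fun n => P (d + n)) B (fun n => dif (d + n)) γ β i))
    (hH : InjDimLT H H n) (i : ℕ) :
    Subsingleton (extGrp k H (fun n => tensObj k M (P n)) (fun n => tensMap k M (dif n))
      (d + i + 1)) := by
  rw [subsingleton_extGrp_succ_iff]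
  exact hom_exact_of_injDimLT
    (d := fun i => tensMap k M (glueMap (fun n => P (d + n)) B (fun n => dif (d + n)) γ β i))
    (fun i => tensObj_projective M (glue_projective (fun n => hP (d + n)) hB i))
    (fun i => range_tensMap_eq_ker M _ _ (hX i)) hH (Int.ofNat i)

end Glue

variable [IsNoetherianRing H]

theorem exists_totally_acyclic_tensor (hS : Function.Bijective (antipode k (A := H))) {n : ℕ}
    (hH : InjDimLT H H (n + 1)) {m : ℕ → ℕ}
    {φ : ∀ n, (Fin (m (n + 1)) → H) →ₗ[H] (Fin (m n) → H)} {aug : (Fin (m 0) → H) →ₗ[H] trivMod k H}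
    (h : IsProjRes (P := fun n => ModuleCat.of H (Fin (m n) → H)) φ aug) (d : ℕ)
    (hd : ∀ i, d < i →
      Subsingleton (extGrp k H (fun n => ModuleCat.of H (Fin (m n) → H)) φ i))
    (M : Type u) [AddCommGroup M] [Module k M] [Module H M] [IsScalarTower k H M] :
    IsGorensteinProjective H (LinearMap.ker
      (tensMap k M (P := ModuleCat.of H (Fin (m (d + 1)) → H)) (Q := ModuleCat.of H (Fin (m d) → H))
        (φ d))) ∧
    ∀ i, Subsingleton (extGrp k H (fun n => tensObj k M (ModuleCat.of H (Fin (m n) → H)))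
      (fun n => tensMap k M (P := ModuleCat.of H (Fin (m (n + 1)) → H))
        (Q := ModuleCat.of H (Fin (m n) → H)) (φ n)) (d + i + 1)) := by
  let s : H ≃ₗ[k] H := LinearEquiv.ofBijective (antipode k) hS
  have hs (a b : H) : s (a * b) = s b * s a := antipode_mul_antidistrib a b
  obtain ⟨B, γ, β, hB, hX⟩ := exists_complete_resolution s hs hH (fun n => m (d + n))
    (fun n => φ (d + n)) (fun n => (h.exact_succ (d + n)).symm) (fun n =>
      range_twistDual_eq_ker s hs _ _ (h.dif_comp (d + n))
        ((subsingleton_extGrp_succ_iff k (d + n)).1 (hd (d + n + 1) (by omega))))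
  exact ⟨isGorensteinProjective_ker_tensMap_glue M h.proj hB hX hH,
    fun i => subsingleton_extGrp_tensMap_glue M h.proj hB hX hH i⟩

theorem lGgldim_lt_top_of_isASGorensteinOfDim (hS : Function.Bijective (antipode k (A := H))) {d : ℕ}
    (hd : IsASGorensteinOfDim k H d) : lGgldim H < ⊤ := by
  obtain ⟨m, φ, aug, h⟩ := exists_free_resolution (R := H) (trivMod k H)
  have h1 := (hd.2 _ _ _ h.proj h.surj h.exact_zero h.exact_succ).1
  refine lt_of_le_of_lt (iSup_le fun M => ?_) (ENat.natCast_lt_top (d + 2))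
  let _ : Module k M := ModuleCat.moduleOfAlgebraModule M
  have : IsScalarTower k H M := ModuleCat.isScalarTower_of_algebra_moduleCat M
  exact sInf_le ⟨d + 2, rfl, gProjDimLE_of_syzygy (h.tensor M) d
    (exists_totally_acyclic_tensor hS (injDimLT_of_injDim_eq hd.1) h d
      (fun i hi => h1 i hi.ne') M).1⟩

theorem isASGorenstein_of_lGgldim_lt_top (hS : Function.Bijective (antipode k (A := H)))
    (hG : lGgldim H < ⊤)
    (hE : ∀ i, Module.Finite k (ModExt H (trivMod k H) H i)) : IsASGorenstein k H := by
  obtain ⟨n, hn⟩ := exists_injDimLT_of_lGgldim hG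
  obtain ⟨m, φ, aug, h⟩ := exists_free_resolution (R := H) (trivMod k H)
  let P (n : ℕ) : ModuleCat.{u} H := ModuleCat.of H (Fin (m n) → H)
  have hfin (i : ℕ) : Module.Finite k (extGrp k H P φ i) := by
    obtain ⟨e⟩ := h.nonempty_extGrp k i
    exact Module.Finite.equiv e.symm
  let s : H ≃ₗ[k] H := LinearEquiv.ofBijective (antipode k) hS
  have hs (a b : H) : s (a * b) = s b * s a := antipode_mul_antidistrib a b
  have hδ := twistComplex_comp s hs φ h.dif_comp
  have hc (j : ℕ) : Module.Finite k (cohomology hδ j) ∧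
      Module.finrank k (cohomology hδ j) = Module.finrank k (extGrp k H P φ j) := by
    obtain ⟨e⟩ := nonempty_extGrp_equiv_cohomology s hs φ hδ j
    exact ⟨Module.Finite.equiv e, e.finrank_eq.symm⟩
  obtain ⟨d, hd, hd'⟩ := exists_unique_cohomology s hs hn finrank_trivMod h hδ
    (fun i => Module.finrank k (extGrp k H P φ i))
    (fun j hj => by
      have := (hc j).1
      exact Module.finrank_zero_iff.1 ((hc j).2.trans hj))
    (fun j q => by
      have := (hc j).1
      have := nonempty_ext_equiv_fin h (M := cohomology hδ j) q
      rwa [(hc j).2] at this)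
  have hd0 (i : ℕ) (hi : i ≠ d) : Subsingleton (extGrp k H P φ i) :=
    Module.finrank_zero_iff.1 (hd' i hi)
  have hinj : InjDimLT H H (d + 1) := by
    refine InjDimLT.of_subsingleton _ fun M i hi => ?_
    obtain ⟨i, rfl⟩ := Nat.exists_eq_add_of_le hi
    let _ : Module k M := ModuleCat.moduleOfAlgebraModule M
    have : IsScalarTower k H M := ModuleCat.isScalarTower_of_algebra_moduleCat M
    have := (exists_totally_acyclic_tensor hS hn h d (fun i hi => hd0 i hi.ne') M).2 i
    obtain ⟨e⟩ := (h.tensor M).nonempty_extGrp k (d + i + 1)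
    rw [show d + 1 + i = d + i + 1 by omega]
    exact e.symm.injective.subsingleton
  refine ⟨d, injDim_eq hinj (trivMod k H) fun hsub => ?_,
    fun P' dif' aug' h1 h2 h3 h4 => ⟨fun i hi => ?_, ?_⟩⟩
  · obtain ⟨e⟩ := h.nonempty_extGrp k d
    have := e.injective.subsingleton
    exact one_ne_zero (hd.symm.trans (Module.finrank_zero_of_subsingleton))
  · have h' : IsProjRes P' dif' aug' := ⟨h1, h2, h3, h4⟩
    obtain ⟨e⟩ := h.nonempty_extGrp k i
    obtain ⟨e'⟩ := h'.nonempty_extGrp k i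
    have := hd0 i hi
    exact (e'.trans e.symm).injective.subsingleton
  · have h' : IsProjRes P' dif' aug' := ⟨h1, h2, h3, h4⟩
    obtain ⟨e⟩ := h.nonempty_extGrp k d
    obtain ⟨e'⟩ := h'.nonempty_extGrp k d
    exact ⟨(e'.trans e.symm).trans (LinearEquiv.ofFinrankEq _ _ (hd.trans
      (Module.finrank_self k).symm))⟩

end Assembly

section Restriction

variable {k : Type u} [Field k] {R R' : Type u} [Ring R] [Ring R'] [Algebra k R] [Algebra k R']
  (σ : R ≃ₐ[k] R')

/-- Restriction of scalars along an isomorphism, on objects. -/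
def resObj (M : ModuleCat.{u} R') : ModuleCat.{u} R :=
  @ModuleCat.of R _ M _ (Module.compHom M (σ : R →+* R'))

/-- Restriction of scalars along an isomorphism, on maps. -/
def resMap {M N : ModuleCat.{u} R'} (f : M →ₗ[R'] N) : resObj σ M →ₗ[R] resObj σ N where
  toFun := f
  map_add' := f.map_add
  map_smul' a x := f.map_smul (σ a) x

/-- Elements of a module as elements of its restriction. -/
def resEquiv (M : ModuleCat.{u} R') :
    letI := RingHomInvPair.of_ringEquiv σ.toRingEquiv
    letI := RingHomInvPair.symm (σ.toRingEquiv : R →+* R') (σ.toRingEquiv.symm : R' →+* R)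
    resObj σ M ≃ₛₗ[(σ.toRingEquiv : R →+* R')] M :=
  letI := RingHomInvPair.of_ringEquiv σ.toRingEquiv
  letI := RingHomInvPair.symm (σ.toRingEquiv : R →+* R') (σ.toRingEquiv.symm : R' →+* R)
  { AddEquiv.refl M with map_smul' := fun _ _ => rfl }

theorem resObj_projective {M : ModuleCat.{u} R'} (h : Module.Projective R' M) :
    Module.Projective R (resObj σ M) := by
  have := RingHomInvPair.of_ringEquiv σ.toRingEquiv
  have := RingHomInvPair.symm (σ.toRingEquiv : R →+* R') (σ.toRingEquiv.symm : R' →+* R)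
  exact Module.Projective.of_equiv (resEquiv σ M).symm

/-- Restriction of scalars on dual modules. -/
def dualRes (M : ModuleCat.{u} R') : (resObj σ M →ₗ[R] R) ≃ₗ[k] (M →ₗ[R'] R') where
  toFun f :=
    { toFun := fun x => σ (f x)
      map_add' := fun x y => (congrArg σ (f.map_add x y)).trans (map_add σ _ _)
      map_smul' := fun a x => by
        obtain ⟨a, rfl⟩ := σ.surjective a
        exact (congrArg σ (f.map_smul a x)).trans (map_mul σ _ _) }
  invFun g :=
    { toFun := fun x => σ.symm (g x)
      map_add' := fun x y => (congrArg σ.symm (g.map_add x y)).trans (map_add σ.symm _ _)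
      map_smul' := fun a x => by
        refine (congrArg σ.symm (g.map_smul (σ a) x)).trans ((map_mul σ.symm _ _).trans ?_)
        rw [σ.symm_apply_apply]
        rfl }
  map_add' f g := by
    ext x
    exact map_add σ _ _
  map_smul' c f := by
    ext x
    exact map_smul σ _ _
  left_inv f := by
    ext x
    exact σ.symm_apply_apply _
  right_inv f := by
    ext x
    exact σ.apply_symm_apply _

variable {P : ℕ → ModuleCat.{u} R'} {dif : ∀ n, P (n + 1) →ₗ[R'] P n}

theorem finite_extGrp_of_resObj (n : ℕ)
    [Module.Finite k (extGrp k R (fun n => resObj σ (P n)) (fun n => resMap σ (dif n)) n)] :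
    Module.Finite k (extGrp k R' P dif n) := by
  let E (n : ℕ) : (Fin 1 → (resObj σ (P n) →ₗ[R] R)) ≃ₗ[k] (P n →ₗ[R'] R') :=
    (LinearEquiv.funUnique (Fin 1) k _).trans (dualRes σ (P n))
  obtain ⟨e⟩ := nonempty_subQuot_equiv_pi (E n)
    (LinearMap.ker (extδ k R (fun n => resObj σ (P n)) (fun n => resMap σ (dif n)) n))
    (extBoundary k R (fun n => resObj σ (P n)) (fun n => resMap σ (dif n)) n)
    (LinearMap.ker (extδ k R' P dif n)) (extBoundary k R' P dif n)
    (fun g => by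
      rw [Unique.forall_iff]
      exact (dualRes σ (P (n + 1))).map_eq_zero_iff (x := (g default).comp (resMap σ (dif n))))
    (fun g => by
      rw [Unique.forall_iff]
      cases n with
      | zero => exact (dualRes σ (P 0)).map_eq_zero_iff
      | succ n =>
        constructor
        · rintro ⟨f, hf⟩
          obtain ⟨f, rfl⟩ := (dualRes σ _).surjective f
          exact ⟨f, (dualRes σ _).injective hf⟩
        · rintro ⟨f, hf⟩
          exact ⟨dualRes σ _ f, congrArg (dualRes σ _) hf⟩)
  exact Module.Finite.equiv e.symm

theorem IsProjRes.res {M : ModuleCat.{u} R'} {aug : P 0 →ₗ[R'] M} (h : IsProjRes P dif aug)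
    {N : Type u} [AddCommGroup N] [Module R N] (e : resObj σ M ≃ₗ[R] N) :
    IsProjRes (fun n => resObj σ (P n)) (fun n => resMap σ (dif n))
      (e.toLinearMap ∘ₗ resMap σ aug) where
  proj n := resObj_projective σ (h.proj n)
  surj := e.surjective.comp h.surj
  exact_zero := by
    rw [LinearEquiv.ker_comp]
    ext x
    exact SetLike.ext_iff.1 h.exact_zero x
  exact_succ n := by
    ext x
    exact SetLike.ext_iff.1 (h.exact_succ n) x

end Restriction

section Opposite

open HopfAlgebra

variable {k : Type u} [Field k] {H : Type u} [Ring H] [HopfAlgebra k H]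

/-- The isomorphism of `H` with its opposite algebra given by a bijective antipode. -/
noncomputable def antipodeOp (hS : Function.Bijective (antipode k (A := H))) : H ≃ₐ[k] Hᵐᵒᵖ :=
  AlgEquiv.ofLinearEquiv ((LinearEquiv.ofBijective (antipode k) hS).trans (MulOpposite.opLinearEquiv k))
    (congrArg MulOpposite.op antipode_one)
    (fun a b => congrArg MulOpposite.op (antipode_mul_antidistrib a b))

/-- The trivial right module, viewed as a left module through the antipode, is trivial. -/
noncomputable def trivModOpEquiv (hS : Function.Bijective (antipode k (A := H))) :
    resObj (antipodeOp hS) (trivModOp k H) ≃ₗ[H] trivMod k H where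
  __ := AddEquiv.refl k
  map_smul' a x := congrArg (fun c : k => @HMul.hMul k k k _ c x) (counit_antipode (R := k) a)

end Opposite

/-- **Statement 17.** Let `H` be a noetherian Hopf algebra over a field `k` with bijective
antipode. Then `H` is AS Gorenstein if and only if `H` has finite Gorenstein global
dimension and both `Ext^i_H(εk, H)` and `Ext^i_{Hᵒᵖ}(k_ε, H)` are finite dimensional over
`k` for all `i` (Ext groups computed from any projective resolution of the trivial
module). -/
theorem isASGorenstein_iff_gorenstein_and_ext_finite (k : Type u) [Field k]
    (H : Type u) [Ring H] [HopfAlgebra k H]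
    [IsNoetherianRing H] [IsNoetherianRing Hᵐᵒᵖ]
    (hS : Function.Bijective (HopfAlgebra.antipode (R := k) (A := H))) :
    IsASGorenstein k H ↔
      (lGgldim H < ⊤ ∧
      (∀ (P : ℕ → ModuleCat.{u} H) (dif : ∀ n, P (n+1) →ₗ[H] P n)
          (aug : P 0 →ₗ[H] trivMod k H),
        (∀ n, Module.Projective H (P n)) → Function.Surjective aug →
        LinearMap.ker aug = LinearMap.range (dif 0) →
        (∀ n, LinearMap.ker (dif n) = LinearMap.range (dif (n+1))) →
        ∀ i : ℕ, Module.Finite k (extGrp k H P dif i)) ∧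
      (∀ (P : ℕ → ModuleCat.{u} Hᵐᵒᵖ) (dif : ∀ n, P (n+1) →ₗ[Hᵐᵒᵖ] P n)
          (aug : P 0 →ₗ[Hᵐᵒᵖ] trivModOp k H),
        (∀ n, Module.Projective Hᵐᵒᵖ (P n)) → Function.Surjective aug →
        LinearMap.ker aug = LinearMap.range (dif 0) →
        (∀ n, LinearMap.ker (dif n) = LinearMap.range (dif (n+1))) →
        ∀ i : ℕ, Module.Finite k (extGrp k Hᵐᵒᵖ P dif i))) := by
  constructor
  · rintro ⟨d, hd⟩
    have hfin (P : ℕ → ModuleCat.{u} H) (dif : ∀ n, P (n + 1) →ₗ[H] P n)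
        (aug : P 0 →ₗ[H] trivMod k H) (h : IsProjRes P dif aug) (i : ℕ) :
        Module.Finite k (extGrp k H P dif i) := by
      obtain ⟨h1, ⟨e⟩⟩ := hd.2 P dif aug h.proj h.surj h.exact_zero h.exact_succ
      by_cases hi : i = d
      · subst hi
        exact Module.Finite.equiv e.symm
      · have := h1 i hi
        infer_instance
    refine ⟨lGgldim_lt_top_of_isASGorensteinOfDim hS hd,
      fun P dif aug h1 h2 h3 h4 => hfin P dif aug ⟨h1, h2, h3, h4⟩,
      fun P dif aug h1 h2 h3 h4 i => ?_⟩
    have h : IsProjRes P dif aug := ⟨h1, h2, h3, h4⟩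
    have := hfin _ _ _ (h.res (antipodeOp hS) (trivModOpEquiv hS)) i
    exact finite_extGrp_of_resObj (antipodeOp hS) i
  · rintro ⟨hG, hE, -⟩
    refine isASGorenstein_of_lGgldim_lt_top hS hG fun i => ?_
    obtain ⟨m, φ, aug, h⟩ := exists_free_resolution (R := H) (trivMod k H)
    obtain ⟨e⟩ := h.nonempty_extGrp k i
    have := hE _ φ aug h.proj h.surj h.exact_zero h.exact_succ i
    exact Module.Finite.equiv e
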